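/- Assume c ∈ O_K with v(c^p − c) ≥ 1 and v(c) < p/((q+1)(p−1)), and let y ∈ Ω be a root of L_c(X). Then the extension K(y)/K is Galois, with Galois group isomorphic to (ℤ/pℤ)^{2n}. -/

import Mathlib

open Polynomial

noncomputable section

/-- `K₀`: the fraction field of the Witt vectors over `𝔽̄_p`, i.e. the completion of `ℚ_p^ur`. -/
abbrev Kzero (p : ℕ) [Fact p.Prime] : Type :=
  FractionRing (WittVector p (AlgebraicClosure (ZMod p)))

/-- `Ω`: a fixed algebraic closure of `K₀`. -/
abbrev Omg (p : ℕ) [Fact p.Prime] : Type := AlgebraicClosure (Kzero p)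

/-- `a_n = (-1)^q · (-p)^(p + p² + ⋯ + pⁿ)` as an element of a commutative ring. -/
def aCoef (R : Type) [CommRing R] (p n : ℕ) : R :=
  (-1) ^ p ^ n * (-(p : R)) ^ (Finset.sum (Finset.range n) fun i => p ^ (i + 1))

/-- `f_{q,c}(X) = 1 + c·X^q + X^(1+q)` with `q = pⁿ`. -/
def fqc (R : Type) [CommRing R] (p n : ℕ) (c : R) : Polynomial R :=
  1 + C c * X ^ p ^ n + X ^ (p ^ n + 1)

/-- The modified monodromy polynomial `L_c(X) = X^(q²) − a_n·(c+X)·f_{q,c}(X)^(q−1)`. -/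
def Lpoly (R : Type) [CommRing R] (p n : ℕ) (c : R) : Polynomial R :=
  X ^ (p ^ n * p ^ n) - C (aCoef R p n) * (C c + X) * fqc R p n c ^ (p ^ n - 1)

set_option maxHeartbeats 2000000
set_option synthInstance.maxHeartbeats 1000000

/-- `v` is an exponential valuation on the field `Ω` with rational values; its value at `0` is
irrelevant. -/
structure IsExpVal {Ω : Type*} [Field Ω] (v : Ω → ℚ) : Prop where
  mul : ∀ x y : Ω, x ≠ 0 → y ≠ 0 → v (x * y) = v x + v y
  add : ∀ x y : Ω, x ≠ 0 → y ≠ 0 → x + y ≠ 0 → min (v x) (v y) ≤ v (x + y)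

/-- The valuation of `x` is at least `r`, where `0` has infinite valuation. -/
def LeVal {Ω : Type*} [Field Ω] (v : Ω → ℚ) (r : ℚ) (x : Ω) : Prop := x = 0 ∨ r ≤ v x

/-- The valuation of `x` is larger than `r`, where `0` has infinite valuation. -/
def LtVal {Ω : Type*} [Field Ω] (v : Ω → ℚ) (r : ℚ) (x : Ω) : Prop := x = 0 ∨ r < v x

section Valuation

variable {Ω : Type*} [Field Ω] {v : Ω → ℚ}

lemma LeVal.zero (r : ℚ) : LeVal v r 0 := Or.inl rfl

lemma LtVal.zero (r : ℚ) : LtVal v r 0 := Or.inl rfl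

lemma LeVal.self (x : Ω) : LeVal v (v x) x := Or.inr le_rfl

lemma LeVal.mono {r s : ℚ} {x : Ω} (hx : LeVal v r x) (h : s ≤ r) : LeVal v s x :=
  hx.imp_right h.trans

lemma LeVal.lt {r s : ℚ} {x : Ω} (hx : LeVal v r x) (h : s < r) : LtVal v s x :=
  hx.imp_right h.trans_le

lemma LtVal.mono {r s : ℚ} {x : Ω} (hx : LtVal v r x) (h : s ≤ r) : LtVal v s x :=
  hx.imp_right h.trans_lt

lemma LtVal.le {r : ℚ} {x : Ω} (hx : LtVal v r x) : LeVal v r x := hx.imp_right le_of_lt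

lemma LeVal.le_val {r : ℚ} {x : Ω} (hx : LeVal v r x) (h : x ≠ 0) : r ≤ v x := hx.resolve_left h

lemma LtVal.lt_val {r : ℚ} {x : Ω} (hx : LtVal v r x) (h : x ≠ 0) : r < v x := hx.resolve_left h

lemma eq_zero_of_ltVal_self {x : Ω} (hx : LtVal v (v x) x) : x = 0 :=
  hx.resolve_right (lt_irrefl _)

lemma eq_zero_of_forall_leVal {x : Ω} (hx : ∀ k : ℕ, LeVal v k x) : x = 0 := by
  by_contra h
  obtain ⟨k, hk⟩ := exists_nat_gt (v x)
  exact absurd ((hx k).le_val h) (not_le.mpr hk)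

namespace IsExpVal

variable (hv : IsExpVal v)
include hv

lemma map_one : v 1 = 0 := by
  have := hv.mul 1 1 one_ne_zero one_ne_zero
  rw [mul_one] at this
  linarith

lemma map_neg_one : v (-1) = 0 := by
  have := hv.mul (-1) (-1) (by simp) (by simp)
  rw [neg_one_mul, neg_neg, hv.map_one] at this
  linarith

lemma map_neg (x : Ω) : v (-x) = v x := by
  by_cases hx : x = 0
  · simp [hx]
  rw [← neg_one_mul, hv.mul _ _ (by simp) hx, hv.map_neg_one, zero_add]

lemma map_inv {x : Ω} (hx : x ≠ 0) : v x⁻¹ = -v x := by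
  have := hv.mul x x⁻¹ hx (inv_ne_zero hx)
  rw [mul_inv_cancel₀ hx, hv.map_one] at this
  linarith

lemma map_div {x y : Ω} (hx : x ≠ 0) (hy : y ≠ 0) : v (x / y) = v x - v y := by
  rw [div_eq_mul_inv, hv.mul _ _ hx (inv_ne_zero hy), hv.map_inv hy, sub_eq_add_neg]

lemma map_pow {x : Ω} (hx : x ≠ 0) (k : ℕ) : v (x ^ k) = k * v x := by
  induction k with
  | zero => simp [hv.map_one]
  | succ k ih =>
    rw [pow_succ, hv.mul _ _ (pow_ne_zero _ hx) hx, ih]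
    push_cast
    ring

lemma map_prod {ι : Type*} (s : Finset ι) (f : ι → Ω) (hf : ∀ i ∈ s, f i ≠ 0) :
    v (∏ i ∈ s, f i) = ∑ i ∈ s, v (f i) := by
  classical
  induction s using Finset.induction_on with
  | empty => simp [hv.map_one]
  | insert a s ha ih =>
    rw [Finset.prod_insert ha, Finset.sum_insert ha, hv.mul, ih]
    · exact fun i hi => hf i (Finset.mem_insert_of_mem hi)
    · exact hf a (Finset.mem_insert_self a s)
    · exact Finset.prod_ne_zero_iff.mpr fun i hi => hf i (Finset.mem_insert_of_mem hi)

lemma le_one : LeVal v 0 (1 : Ω) := Or.inr hv.map_one.ge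

lemma le_neg {r : ℚ} {x : Ω} (hx : LeVal v r x) : LeVal v r (-x) := by
  rcases hx with rfl | hx
  · exact Or.inl neg_zero
  · exact Or.inr (by rwa [hv.map_neg])

lemma lt_neg {r : ℚ} {x : Ω} (hx : LtVal v r x) : LtVal v r (-x) := by
  rcases hx with rfl | hx
  · exact Or.inl neg_zero
  · exact Or.inr (by rwa [hv.map_neg])

lemma le_add {r : ℚ} {x y : Ω} (hx : LeVal v r x) (hy : LeVal v r y) : LeVal v r (x + y) := by
  rcases hx with rfl | hx
  · rwa [zero_add]
  rcases hy with rfl | hy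
  · rw [add_zero]; exact Or.inr hx
  by_cases hx0 : x = 0
  · rw [hx0, zero_add]; exact Or.inr hy
  by_cases hy0 : y = 0
  · rw [hy0, add_zero]; exact Or.inr hx
  by_cases h : x + y = 0
  · exact Or.inl h
  · exact Or.inr ((le_min hx hy).trans (hv.add x y hx0 hy0 h))

lemma lt_add {r : ℚ} {x y : Ω} (hx : LtVal v r x) (hy : LtVal v r y) : LtVal v r (x + y) := by
  rcases hx with rfl | hx
  · rwa [zero_add]
  rcases hy with rfl | hy
  · rw [add_zero]; exact Or.inr hx
  exact LeVal.lt (hv.le_add (r := min (v x) (v y)) (Or.inr (min_le_left _ _))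
    (Or.inr (min_le_right _ _))) (lt_min hx hy)

lemma le_sub {r : ℚ} {x y : Ω} (hx : LeVal v r x) (hy : LeVal v r y) : LeVal v r (x - y) := by
  rw [sub_eq_add_neg]; exact hv.le_add hx (hv.le_neg hy)

lemma lt_sub {r : ℚ} {x y : Ω} (hx : LtVal v r x) (hy : LtVal v r y) : LtVal v r (x - y) := by
  rw [sub_eq_add_neg]; exact hv.lt_add hx (hv.lt_neg hy)

lemma le_mul {r s : ℚ} {x y : Ω} (hx : LeVal v r x) (hy : LeVal v s y) :
    LeVal v (r + s) (x * y) := by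
  by_cases hx0 : x = 0
  · exact Or.inl (by simp [hx0])
  by_cases hy0 : y = 0
  · exact Or.inl (by simp [hy0])
  exact Or.inr (by rw [hv.mul _ _ hx0 hy0]; exact add_le_add (hx.le_val hx0) (hy.le_val hy0))

lemma lt_mul_le {r s : ℚ} {x y : Ω} (hx : LtVal v r x) (hy : LeVal v s y) :
    LtVal v (r + s) (x * y) := by
  by_cases hx0 : x = 0
  · exact Or.inl (by simp [hx0])
  by_cases hy0 : y = 0
  · exact Or.inl (by simp [hy0])
  exact Or.inr (by
    rw [hv.mul _ _ hx0 hy0]; exact add_lt_add_of_lt_of_le (hx.lt_val hx0) (hy.le_val hy0))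

lemma le_pow {r : ℚ} {x : Ω} (hx : LeVal v r x) (k : ℕ) : LeVal v (k * r) (x ^ k) := by
  induction k with
  | zero => simpa using hv.le_one
  | succ k ih =>
    rw [pow_succ]
    exact (hv.le_mul ih hx).mono (by push_cast; linarith)

lemma le_pow_zero {x : Ω} (hx : LeVal v 0 x) (k : ℕ) : LeVal v 0 (x ^ k) := by
  simpa using hv.le_pow hx k

lemma le_sum {ι : Type*} {r : ℚ} (s : Finset ι) (f : ι → Ω) (hf : ∀ i ∈ s, LeVal v r (f i)) :
    LeVal v r (∑ i ∈ s, f i) :=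
  Finset.sum_induction f (LeVal v r) (fun _ _ => hv.le_add) (LeVal.zero r) hf

lemma lt_sum {ι : Type*} {r : ℚ} (s : Finset ι) (f : ι → Ω) (hf : ∀ i ∈ s, LtVal v r (f i)) :
    LtVal v r (∑ i ∈ s, f i) :=
  Finset.sum_induction f (LtVal v r) (fun _ _ => hv.lt_add) (LtVal.zero r) hf

lemma le_natCast (k : ℕ) : LeVal v 0 (k : Ω) := by
  induction k with
  | zero => exact Or.inl Nat.cast_zero
  | succ k ih => rw [Nat.cast_succ]; exact hv.le_add ih hv.le_one

lemma le_div {r : ℚ} {x y : Ω} (hx : LeVal v r x) (hy : y ≠ 0) : LeVal v (r - v y) (x / y) := by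
  rw [div_eq_mul_inv, sub_eq_add_neg, ← hv.map_inv hy]
  exact hv.le_mul hx (LeVal.self _)

lemma lt_div {r : ℚ} {x y : Ω} (hx : LtVal v r x) (hy : y ≠ 0) : LtVal v (r - v y) (x / y) := by
  rw [div_eq_mul_inv, sub_eq_add_neg, ← hv.map_inv hy]
  exact hv.lt_mul_le hx (LeVal.self _)

lemma add_dominant {x y : Ω} (hx : x ≠ 0) (hy : LtVal v (v x) y) :
    x + y ≠ 0 ∧ v (x + y) = v x := by
  have key : ¬ LtVal v (v x) (x + y) := fun h => hx (eq_zero_of_ltVal_self (by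
    simpa using hv.lt_sub h hy))
  refine ⟨fun h => key (Or.inl h), le_antisymm (not_lt.mp fun h => key (Or.inr h)) ?_⟩
  exact (hv.le_add (LeVal.self x) hy.le).le_val fun h => key (Or.inl h)

lemma le_pow_imp {r : ℚ} {x : Ω} {k : ℕ} (hk : k ≠ 0) (h : LeVal v (k * r) (x ^ k)) :
    LeVal v r x := by
  by_cases hx : x = 0
  · exact Or.inl hx
  right
  have := h.le_val (pow_ne_zero _ hx)
  rw [hv.map_pow hx] at this
  exact le_of_mul_le_mul_left this (by positivity)

lemma lt_pow_imp {x : Ω} {k : ℕ} (hk : k ≠ 0) (h : LtVal v 0 (x ^ k)) : LtVal v 0 x := by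
  by_cases hx : x = 0
  · exact Or.inl hx
  right
  have := h.lt_val (pow_ne_zero _ hx)
  rw [hv.map_pow hx] at this
  exact pos_of_mul_pos_right this (by positivity)

/-- A sum of terms with pairwise distinct valuations vanishes only if all terms do, and otherwise
has the valuation of one of its terms, which is minimal. -/
lemma sum_distinct {ι : Type*} (s : Finset ι) (f : ι → Ω)
    (hf : ∀ i ∈ s, ∀ j ∈ s, f i ≠ 0 → f j ≠ 0 → v (f i) = v (f j) → i = j) :
    (∀ i ∈ s, f i = 0) ∨
      (∑ i ∈ s, f i ≠ 0 ∧ (∃ i ∈ s, f i ≠ 0 ∧ v (∑ i ∈ s, f i) = v (f i)) ∧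
        ∀ j ∈ s, LeVal v (v (∑ i ∈ s, f i)) (f j)) := by
  classical
  induction s using Finset.induction_on with
  | empty => simp
  | insert a s ha ih =>
    rw [Finset.sum_insert ha]
    by_cases ha0 : f a = 0
    · rcases ih (fun i hi j hj => hf i (Finset.mem_insert_of_mem hi) j
        (Finset.mem_insert_of_mem hj)) with h | ⟨h0, ⟨i, hi, hi0, hiv⟩, hmin⟩
      · exact Or.inl (by simpa [ha0] using h)
      · right
        rw [ha0, zero_add]
        refine ⟨h0, ⟨i, Finset.mem_insert_of_mem hi, hi0, hiv⟩, fun j hj => ?_⟩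
        rcases Finset.mem_insert.mp hj with rfl | hj
        · exact Or.inl ha0
        · exact hmin j hj
    right
    rcases ih (fun i hi j hj => hf i (Finset.mem_insert_of_mem hi) j
        (Finset.mem_insert_of_mem hj)) with h | ⟨h0, ⟨i, hi, hi0, hiv⟩, hmin⟩
    · rw [Finset.sum_eq_zero h, add_zero]
      refine ⟨ha0, ⟨a, Finset.mem_insert_self a s, ha0, rfl⟩, fun j hj => ?_⟩
      rcases Finset.mem_insert.mp hj with rfl | hj
      · exact LeVal.self _
      · exact Or.inl (h j hj)
    · have hne : v (f a) ≠ v (∑ i ∈ s, f i) := fun h => ha (by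
        rw [hf a (Finset.mem_insert_self a s) i (Finset.mem_insert_of_mem hi) ha0 hi0
          (h.trans hiv)]
        exact hi)
      rcases lt_or_gt_of_ne hne with hlt | hlt
      · obtain ⟨h1, h2⟩ := hv.add_dominant ha0 (Or.inr hlt)
        rw [h2]
        refine ⟨h1, ⟨a, Finset.mem_insert_self a s, ha0, rfl⟩, fun j hj => ?_⟩
        rcases Finset.mem_insert.mp hj with rfl | hj
        · exact LeVal.self _
        · exact (hmin j hj).mono hlt.le
      · obtain ⟨h1, h2⟩ := hv.add_dominant h0 (Or.inr hlt)
        rw [add_comm] at h1 h2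
        rw [h2]
        refine ⟨h1, ⟨i, Finset.mem_insert_of_mem hi, hi0, hiv⟩, fun j hj => ?_⟩
        rcases Finset.mem_insert.mp hj with rfl | hj
        · exact Or.inr hlt.le
        · exact hmin j hj

end IsExpVal

end Valuation

/-- The valuation `v` on `Ω` restricts to the `p`-adic valuation of `K₀`, whose valuation ring is
the image of `W`. -/
structure IsPadicBase (p : ℕ) (W K₀ : Type*) {Ω : Type*} [CommRing W] [Field K₀] [Field Ω]
    [Algebra W K₀] [Algebra K₀ Ω] [Algebra W Ω] (v : Ω → ℚ) : Prop where
  val : IsExpVal v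
  val_p : v (p : Ω) = 1
  le_base : ∀ w : W, LeVal v 0 (algebraMap W Ω w)
  int : ∀ k : K₀, k ≠ 0 → ∃ m : ℤ, v (algebraMap K₀ Ω k) = m
  lift : ∀ k : K₀, LeVal v 0 (algebraMap K₀ Ω k) → ∃ w : W, algebraMap W K₀ w = k

section TotallyRamified

variable {p : ℕ} {W K₀ Ω : Type*} [CommRing W] [Field K₀] [Field Ω] [Algebra W K₀]
  [Algebra K₀ Ω] [Algebra W Ω] {v : Ω → ℚ}

/-- A nonzero element of `K₀` of positive valuation has valuation at least `1`. -/
lemma IsPadicBase.one_le (h : IsPadicBase p W K₀ v) (k : K₀) {r : ℚ} (hr : -1 < r)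
    (hk : LeVal v r (algebraMap K₀ Ω k)) : LeVal v 0 (algebraMap K₀ Ω k) := by
  by_cases hk0 : k = 0
  · exact Or.inl (by simp [hk0])
  obtain ⟨m, hm⟩ := h.int k hk0
  have h1 := hk.le_val (by simpa using hk0)
  right
  rw [hm] at h1 ⊢
  have : (-1 : ℤ) < m := by exact_mod_cast hr.trans_le h1
  exact_mod_cast (by omega : 0 ≤ m)

lemma IsPadicBase.terms_distinct (h : IsPadicBase p W K₀ v) {N : ℕ} (hN : N ≠ 0)
    {π : Ω} (hπ0 : π ≠ 0) (hπ : v π = 1 / N) (k : Fin N → K₀) (i j : Fin N)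
    (hi : algebraMap K₀ Ω (k i) * π ^ (i : ℕ) ≠ 0)
    (hj : algebraMap K₀ Ω (k j) * π ^ (j : ℕ) ≠ 0)
    (hij : v (algebraMap K₀ Ω (k i) * π ^ (i : ℕ)) =
      v (algebraMap K₀ Ω (k j) * π ^ (j : ℕ))) : i = j := by
  obtain ⟨a, ha⟩ := h.int (k i) (fun h0 => hi (by simp [h0]))
  obtain ⟨b, hb⟩ := h.int (k j) (fun h0 => hj (by simp [h0]))
  rw [h.val.mul _ _ (left_ne_zero_of_mul hi) (right_ne_zero_of_mul hi),
    h.val.mul _ _ (left_ne_zero_of_mul hj) (right_ne_zero_of_mul hj), ha, hb,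
    h.val.map_pow hπ0, h.val.map_pow hπ0, hπ] at hij
  have hN' : (N : ℚ) ≠ 0 := by exact_mod_cast hN
  field_simp at hij
  have hij' : a * (N : ℤ) + (i : ℕ) = N * b + (j : ℕ) := by exact_mod_cast hij
  rw [mul_comm a] at hij'
  have hi' : ((i : ℕ) : ℤ) % N = (i : ℕ) := Int.emod_eq_of_lt (by omega) (by omega)
  have hj' : ((j : ℕ) : ℤ) % N = (j : ℕ) := Int.emod_eq_of_lt (by omega) (by omega)
  have := congrArg (· % (N : ℤ)) hij'
  simp only [Int.mul_add_emod_self_left] at this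
  rw [hi', hj'] at this
  exact Fin.ext (by exact_mod_cast this)

variable {F : Type*} [Field F] [Algebra K₀ F] [Algebra F Ω] [IsScalarTower K₀ F Ω]
  {N : ℕ} {π : F}

lemma IsPadicBase.linearIndependent (h : IsPadicBase p W K₀ v) (hN : N ≠ 0)
    (hπ0 : π ≠ 0) (hπ : v (algebraMap F Ω π) = 1 / N) :
    LinearIndependent K₀ (fun i : Fin N => π ^ (i : ℕ)) := by
  have hπ0' : algebraMap F Ω π ≠ 0 := by simpa using hπ0
  rw [Fintype.linearIndependent_iff]
  intro k hk i
  have hk' : ∑ i, algebraMap K₀ Ω (k i) * algebraMap F Ω π ^ (i : ℕ) = 0 := by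
    have := congrArg (algebraMap F Ω) hk
    simpa [Algebra.smul_def, ← IsScalarTower.algebraMap_apply] using this
  rcases h.val.sum_distinct Finset.univ
    (fun i : Fin N => algebraMap K₀ Ω (k i) * algebraMap F Ω π ^ (i : ℕ))
    (fun i _ j _ => h.terms_distinct hN hπ0' hπ k i j) with h0 | ⟨h0, -⟩
  · have := h0 i (Finset.mem_univ i)
    simpa [hπ0] using this
  · exact absurd hk' h0

variable [IsScalarTower W K₀ Ω]

/-- In a totally ramified extension of `K₀`, the powers of a uniformizer give an expansion of any
element into terms which are at least as small as the element itself. -/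
lemma IsPadicBase.exists_expansion (h : IsPadicBase p W K₀ v) (hN : N ≠ 0)
    (hπ0 : π ≠ 0) (hπ : v (algebraMap F Ω π) = 1 / N) [FiniteDimensional K₀ F]
    (hF : Module.finrank K₀ F ≤ N) {r : ℚ} (hr : 0 ≤ r) (x : F)
    (hx : LeVal v r (algebraMap F Ω x)) :
    ∃ w : Fin N → W,
      (algebraMap F Ω x = ∑ i, algebraMap W Ω (w i) * algebraMap F Ω π ^ (i : ℕ)) ∧
      ∀ i, LeVal v r (algebraMap W Ω (w i) * algebraMap F Ω π ^ (i : ℕ)) := by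
  have hli := h.linearIndependent hN hπ0 hπ
  have hπ0' : algebraMap F Ω π ≠ 0 := by simpa using hπ0
  have : Nonempty (Fin N) := ⟨⟨0, Nat.pos_of_ne_zero hN⟩⟩
  have hcard : Fintype.card (Fin N) = Module.finrank K₀ F :=
    le_antisymm hli.fintype_card_le_finrank (by simpa using hF)
  have hspan := hli.span_eq_top_of_card_eq_finrank hcard
  have hxs : x ∈ Submodule.span K₀ (Set.range fun i : Fin N => π ^ (i : ℕ)) := by
    rw [hspan]; exact Submodule.mem_top
  obtain ⟨k, hk⟩ := (Submodule.mem_span_range_iff_exists_fun K₀).mp hxs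
  have hk' : algebraMap F Ω x = ∑ i, algebraMap K₀ Ω (k i) * algebraMap F Ω π ^ (i : ℕ) := by
    have := congrArg (algebraMap F Ω) hk
    simpa [Algebra.smul_def, ← IsScalarTower.algebraMap_apply] using this.symm
  have hterm : ∀ i, LeVal v r (algebraMap K₀ Ω (k i) * algebraMap F Ω π ^ (i : ℕ)) := by
    intro i
    rcases h.val.sum_distinct Finset.univ
      (fun i : Fin N => algebraMap K₀ Ω (k i) * algebraMap F Ω π ^ (i : ℕ))
      (fun i _ j _ => h.terms_distinct hN hπ0' hπ k i j) with h0 | ⟨h0, -, hmin⟩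
    · exact Or.inl (h0 i (Finset.mem_univ i))
    · rw [← hk'] at h0 hmin
      exact (hmin i (Finset.mem_univ i)).mono (hx.le_val h0)
  have hlift : ∀ i, ∃ w : W, algebraMap W K₀ w = k i := by
    intro i
    refine h.lift _ (h.one_le (k i) (r := 0 - v (algebraMap F Ω π ^ (i : ℕ))) ?_ ?_)
    · rw [h.val.map_pow hπ0', hπ]
      have hlt : ((i : ℕ) : ℚ) < N := by exact_mod_cast i.2
      have hN' : (0 : ℚ) < N := by positivity
      have : ((i : ℕ) : ℚ) * (1 / N) < 1 := by
        rw [mul_one_div, div_lt_one hN']; exact hlt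
      linarith
    · have := h.val.le_div ((hterm i).mono hr) (pow_ne_zero (i : ℕ) hπ0')
      rwa [mul_div_cancel_right₀ _ (pow_ne_zero _ hπ0')] at this
  choose w hw using hlift
  have hw' : ∀ i, algebraMap W Ω (w i) = algebraMap K₀ Ω (k i) := fun i => by
    rw [IsScalarTower.algebraMap_apply W K₀ Ω, hw]
  exact ⟨w, by simp only [hw', hk'], fun i => by rw [hw']; exact hterm i⟩

/-- The residue field of a totally ramified extension is that of `W`. -/
lemma IsPadicBase.exists_residue (h : IsPadicBase p W K₀ v) (hN : N ≠ 0)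
    (hπ0 : π ≠ 0) (hπ : v (algebraMap F Ω π) = 1 / N) [FiniteDimensional K₀ F]
    (hF : Module.finrank K₀ F ≤ N) (x : F) (hx : LeVal v 0 (algebraMap F Ω x)) :
    ∃ w : W, LtVal v 0 (algebraMap F Ω x - algebraMap W Ω w) := by
  obtain ⟨w, hw, -⟩ := h.exists_expansion hN hπ0 hπ hF le_rfl x hx
  have hπ0' : algebraMap F Ω π ≠ 0 := by simpa using hπ0
  refine ⟨w ⟨0, Nat.pos_of_ne_zero hN⟩, ?_⟩
  rw [hw, ← Finset.add_sum_erase _ _ (Finset.mem_univ (⟨0, Nat.pos_of_ne_zero hN⟩ : Fin N))]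
  simp only [pow_zero, mul_one, add_sub_cancel_left]
  refine h.val.lt_sum _ _ fun i hi => ?_
  have hi0 : (i : ℕ) ≠ 0 := fun h0 => (Finset.mem_erase.mp hi).1 (Fin.ext h0)
  refine (h.val.le_mul (h.le_base (w i)) (LeVal.self _)).lt ?_
  rw [h.val.map_pow hπ0', hπ]
  positivity

/-- Partial sums of `p`-adic series converge in `W`. -/
lemma exists_padic_sum [IsAdicComplete (Ideal.span {(p : W)}) W] (w : ℕ → W) :
    ∃ s : W, ∀ k, ∃ t, s - ∑ j ∈ Finset.range k, (p : W) ^ j * w j = (p : W) ^ k * t := by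
  obtain ⟨s, hs⟩ := IsPrecomplete.prec' (I := Ideal.span {(p : W)}) (M := W)
    (fun k => ∑ j ∈ Finset.range k, (p : W) ^ j * w j) (by
      intro m n hmn
      rw [SModEq.sub_mem, Ideal.span_singleton_pow, smul_eq_mul, Ideal.mul_top,
        Ideal.mem_span_singleton, ← neg_sub, dvd_neg, ← Finset.sum_Ico_eq_sub _ hmn]
      exact Finset.dvd_sum fun i hi =>
        Dvd.dvd.mul_right (pow_dvd_pow _ (Finset.mem_Ico.mp hi).1) _)
  refine ⟨s, fun k => ?_⟩
  have := (hs k).symm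
  rw [SModEq.sub_mem, Ideal.span_singleton_pow, smul_eq_mul, Ideal.mul_top,
    Ideal.mem_span_singleton] at this
  exact this

/-- A totally ramified extension of `K₀` is complete, hence closed in `Ω`. -/
lemma IsPadicBase.mem_range_of_approx (h : IsPadicBase p W K₀ v)
    [IsAdicComplete (Ideal.span {(p : W)}) W] (hN : N ≠ 0)
    (hπ0 : π ≠ 0) (hπ : v (algebraMap F Ω π) = 1 / N) [FiniteDimensional K₀ F]
    (hF : Module.finrank K₀ F ≤ N) (hp0 : (p : Ω) ≠ 0) (s : Ω)
    (hs : ∀ k : ℕ, ∃ x : F, LeVal v k (s - algebraMap F Ω x)) :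
    ∃ x : F, algebraMap F Ω x = s := by
  have hp0F : (p : F) ≠ 0 := fun h0 => hp0 (by simpa using congrArg (algebraMap F Ω) h0)
  choose x hx using hs
  have hstep : ∀ k, ∃ w : Fin N → W, algebraMap F Ω ((x (k + 1) - x k) / (p : F) ^ k) =
      ∑ i, algebraMap W Ω (w i) * algebraMap F Ω π ^ (i : ℕ) := by
    intro k
    obtain ⟨w, hw, -⟩ := h.exists_expansion hN hπ0 hπ hF le_rfl ((x (k + 1) - x k) / (p : F) ^ k)
      (by
        have h1 := h.val.le_sub (hx k) ((hx (k + 1)).mono (by push_cast; linarith))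
        have h2 := h.val.le_div h1 (pow_ne_zero k hp0)
        rw [h.val.map_pow hp0, h.val_p, mul_one, sub_self] at h2
        convert h2 using 1
        simp)
    exact ⟨w, hw⟩
  choose w hw using hstep
  have hsum : ∀ i : Fin N, ∃ s : W, ∀ k, ∃ t,
      s - ∑ j ∈ Finset.range k, (p : W) ^ j * w j i = (p : W) ^ k * t :=
    fun i => exists_padic_sum fun j => w j i
  choose S T hST using hsum
  have hpart : ∀ k, algebraMap F Ω (x k) = algebraMap F Ω (x 0) +
      ∑ i, algebraMap W Ω (∑ j ∈ Finset.range k, (p : W) ^ j * w j i) *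
        algebraMap F Ω π ^ (i : ℕ) := by
    intro k
    induction k with
    | zero => simp
    | succ k ih =>
      have e : algebraMap F Ω (x (k + 1)) = algebraMap F Ω (x k) + (p : Ω) ^ k *
          ∑ i, algebraMap W Ω (w k i) * algebraMap F Ω π ^ (i : ℕ) := by
        rw [← hw k]
        simp only [map_div₀, map_sub, map_pow, map_natCast]
        rw [mul_div_cancel₀ _ (pow_ne_zero k hp0)]
        ring
      rw [e, ih, add_assoc, Finset.mul_sum, ← Finset.sum_add_distrib]
      congr 1
      refine Finset.sum_congr rfl fun i _ => ?_
      rw [Finset.sum_range_succ, map_add, map_mul, map_pow, map_natCast]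
      ring
  have hπle : LeVal v 0 (algebraMap F Ω π) := Or.inr (by rw [hπ]; positivity)
  refine ⟨x 0 + ∑ i, algebraMap K₀ F (algebraMap W K₀ (S i)) * π ^ (i : ℕ), ?_⟩
  rw [eq_comm, ← sub_eq_zero]
  refine eq_zero_of_forall_leVal (v := v) fun k => ?_
  have e : s - algebraMap F Ω (x 0 + ∑ i, algebraMap K₀ F (algebraMap W K₀ (S i)) * π ^ (i : ℕ)) =
      (s - algebraMap F Ω (x k)) -
        ∑ i, (p : Ω) ^ k * algebraMap W Ω (T i k) * algebraMap F Ω π ^ (i : ℕ) := by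
    have e1 : ∀ i, (p : Ω) ^ k * algebraMap W Ω (T i k) = algebraMap W Ω (S i) -
        algebraMap W Ω (∑ j ∈ Finset.range k, (p : W) ^ j * w j i) := fun i => by
      rw [← map_sub, hST i k, map_mul, map_pow, map_natCast]
    simp only [e1, sub_mul, Finset.sum_sub_distrib]
    rw [hpart k, map_add, map_sum]
    simp only [map_mul, map_pow, ← IsScalarTower.algebraMap_apply]
    ring
  rw [e]
  refine h.val.le_sub (hx k) (h.val.le_sum _ _ fun i _ => ?_)
  have hpk : LeVal v k ((p : Ω) ^ k) := Or.inr (by rw [h.val.map_pow hp0, h.val_p, mul_one])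
  have := h.val.le_mul (h.val.le_mul hpk (h.le_base (T i k)))
    (h.val.le_pow_zero hπle (i : ℕ))
  simpa using this

/-- Automorphisms of a totally ramified extension act trivially on the residue field. -/
lemma IsPadicBase.aut_sub_lt (h : IsPadicBase p W K₀ v) (hN : N ≠ 0)
    (hπ0 : π ≠ 0) (hπ : v (algebraMap F Ω π) = 1 / N) [FiniteDimensional K₀ F]
    (hF : Module.finrank K₀ F ≤ N) (σ : F ≃ₐ[K₀] F) (x : F)
    (hx : LeVal v 0 (algebraMap F Ω x)) :
    LtVal v 0 (algebraMap F Ω (σ x) - algebraMap F Ω x) := by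
  have hπ0' : algebraMap F Ω π ≠ 0 := by simpa using hπ0
  have hNpos : (0 : ℚ) < N := by positivity
  have hπlt : LtVal v 0 (algebraMap F Ω π) := Or.inr (by rw [hπ]; positivity)
  have hσ : ∀ (x : F) (w : Fin N → W),
      algebraMap F Ω x = ∑ i, algebraMap W Ω (w i) * algebraMap F Ω π ^ (i : ℕ) →
      algebraMap F Ω (σ x) =
        ∑ i, algebraMap W Ω (w i) * algebraMap F Ω (σ π) ^ (i : ℕ) := by
    intro x w hw
    have hxw : x = ∑ i, algebraMap K₀ F (algebraMap W K₀ (w i)) * π ^ (i : ℕ) := by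
      apply (algebraMap F Ω).injective
      rw [hw, map_sum]
      simp only [map_mul, map_pow, ← IsScalarTower.algebraMap_apply]
    rw [hxw]
    simp only [map_sum, map_mul, map_pow, AlgEquiv.commutes, ← IsScalarTower.algebraMap_apply]
  have hvN : v (algebraMap F Ω (π ^ N)) = 1 := by
    rw [map_pow, h.val.map_pow hπ0', hπ]
    field_simp
  obtain ⟨w, hw, hwle⟩ := h.exists_expansion hN hπ0 hπ hF zero_le_one (π ^ N) (Or.inr hvN.ge)
  have hwlt : ∀ i, LtVal v 0 (algebraMap W Ω (w i)) := by
    intro i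
    have h1 := h.val.le_div (hwle i) (pow_ne_zero (i : ℕ) hπ0')
    rw [mul_div_cancel_right₀ _ (pow_ne_zero _ hπ0'), h.val.map_pow hπ0', hπ] at h1
    refine h1.lt ?_
    have hlt : ((i : ℕ) : ℚ) < N := by exact_mod_cast i.2
    rw [mul_one_div, sub_pos, div_lt_one hNpos]
    exact hlt
  have hroot := hσ _ w hw
  rw [map_pow, map_pow] at hroot
  have hσ0 : algebraMap F Ω (σ π) ≠ 0 := by simpa using hπ0
  have hσle : LeVal v 0 (algebraMap F Ω (σ π)) := by
    by_contra hcon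
    have hneg : v (algebraMap F Ω (σ π)) < 0 := by
      by_contra h'
      exact hcon (Or.inr (not_lt.mp h'))
    apply pow_ne_zero N hσ0
    refine eq_zero_of_ltVal_self (v := v) ?_
    nth_rewrite 2 [hroot]
    refine h.val.lt_sum _ _ fun i _ =>
      (h.val.le_mul (h.le_base (w i)) (LeVal.self _)).lt ?_
    rw [h.val.map_pow hσ0, h.val.map_pow hσ0, zero_add]
    have hlt : ((i : ℕ) : ℚ) < N := by exact_mod_cast i.2
    exact mul_lt_mul_of_neg_right hlt hneg
  have hσlt : LtVal v 0 (algebraMap F Ω (σ π)) := by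
    refine h.val.lt_pow_imp hN ?_
    rw [hroot]
    refine h.val.lt_sum _ _ fun i _ => ?_
    simpa using h.val.lt_mul_le (hwlt i) (h.val.le_pow_zero hσle (i : ℕ))
  obtain ⟨u, hu, -⟩ := h.exists_expansion hN hπ0 hπ hF le_rfl x hx
  rw [hσ x u hu, hu, ← Finset.sum_sub_distrib]
  refine h.val.lt_sum _ _ fun i _ => ?_
  rw [← mul_sub, mul_comm]
  have hpow : ∀ z : Ω, LtVal v 0 z → ∀ k : ℕ, k ≠ 0 → LtVal v 0 (z ^ k) := by
    intro z hz k hk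
    obtain ⟨m, rfl⟩ := Nat.exists_eq_succ_of_ne_zero hk
    rw [pow_succ']
    simpa using h.val.lt_mul_le hz (h.val.le_pow_zero hz.le m)
  have hdiff : LtVal v 0 (algebraMap F Ω (σ π) ^ (i : ℕ) - algebraMap F Ω π ^ (i : ℕ)) := by
    by_cases hi : (i : ℕ) = 0
    · exact Or.inl (by simp [hi])
    · exact h.val.lt_sub (hpow _ hσlt _ hi) (hpow _ hπlt _ hi)
  simpa using h.val.lt_mul_le hdiff (h.le_base (u i))

end TotallyRamified

section Residue

variable {p : ℕ} {W k Ω : Type*} [CommRing W] [Field k] [IsAlgClosed k] [Field Ω] [Algebra W Ω]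
  {v : Ω → ℚ}

/-- If the residue field is algebraically closed, then an approximate root in `Ω` of a monic
polynomial over `W` is close to an element of `W`. -/
lemma IsExpVal.exists_near_of_eval_lt (hv : IsExpVal v) (hp : LtVal v 0 (p : Ω))
    (hW : ∀ w : W, LeVal v 0 (algebraMap W Ω w)) (φ : W →+* k) (hφ : Function.Surjective φ)
    (hker : RingHom.ker φ = Ideal.span {(p : W)}) (P : W[X]) (hP : P.Monic) (t : Ω)
    (ht : LeVal v 0 t) (hPt : LtVal v 0 (aeval t P)) :
    ∃ w : W, LtVal v 0 (t - algebraMap W Ω w) := by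
  classical
  have hsplit := (IsAlgClosed.splits (P.map φ)).eq_prod_roots_of_monic (hP.map φ)
  choose g hg using hφ
  set R : W[X] := (((P.map φ).roots.map g).map fun w => X - C w).prod with hR
  have hRP : R.map φ = P.map φ := by
    rw [hsplit, hR, Polynomial.map_multiset_prod, Multiset.map_map, Multiset.map_map]
    congr 1
    refine Multiset.map_congr rfl fun x _ => ?_
    simp [hg]
  have hcoeff : ∀ i, LtVal v 0 (algebraMap W Ω ((P - R).coeff i)) := by
    intro i
    have hmem : (P - R).coeff i ∈ RingHom.ker φ := by
      have := congrArg (fun Q => Q.coeff i) hRP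
      simp only [coeff_map] at this
      rw [RingHom.mem_ker, coeff_sub, map_sub, this, sub_self]
    rw [hker, Ideal.mem_span_singleton] at hmem
    obtain ⟨d, hd⟩ := hmem
    rw [hd, map_mul, map_natCast]
    simpa using hv.lt_mul_le hp (hW d)
  have hRt : LtVal v 0 (aeval t R) := by
    have h1 : LtVal v 0 (aeval t (P - R)) := by
      rw [aeval_eq_sum_range]
      refine hv.lt_sum _ _ fun i _ => ?_
      rw [Algebra.smul_def]
      simpa using hv.lt_mul_le (hcoeff i) (hv.le_pow_zero ht i)
    have := hv.lt_sub hPt h1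
    rwa [map_sub, sub_sub_cancel] at this
  have hprod : ∀ s : Multiset W, LtVal v 0 (aeval t ((s.map fun w => X - C w).prod)) →
      ∃ w : W, LtVal v 0 (t - algebraMap W Ω w) := by
    intro s
    induction s using Multiset.induction_on with
    | empty =>
      intro h
      rcases h with h | h
      · simp at h
      · simp [hv.map_one] at h
    | cons a s ih =>
      intro h
      by_contra hcon
      push Not at hcon
      rw [Multiset.map_cons, Multiset.prod_cons, map_mul, map_sub, aeval_X, aeval_C] at h
      have ha := hcon a
      have ha0 : t - algebraMap W Ω a ≠ 0 := fun h0 => ha (Or.inl h0)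
      have hva : v (t - algebraMap W Ω a) ≤ 0 := not_lt.mp fun h0 => ha (Or.inr h0)
      refine absurd (ih ?_) (by push Not; exact hcon)
      have := hv.lt_div h ha0
      rw [mul_div_cancel_left₀ _ ha0] at this
      exact this.mono (by linarith)
  exact hprod _ hRt

end Residue

/-- The value at `x` of `X ^ q² - a (c + X) f(X) ^ (q - 1)`, where
`f = 1 + c X ^ q + X ^ (q + 1)`. -/
def monodromyEval {Ω : Type*} [Field Ω] (q : ℕ) (a c x : Ω) : Ω :=
  x ^ (q * q) - a * (c + x) * (1 + c * x ^ q + x ^ (q + 1)) ^ (q - 1)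

/-- The valuations of the coefficients of the monodromy polynomial, expressed through the
expected valuation `ρ` of the differences of its roots. -/
structure IsMonodromyDatum {Ω : Type*} [Field Ω] (v : Ω → ℚ) (p n : ℕ) (a c : Ω) (ρ : ℚ) :
    Prop where
  val : IsExpVal v
  prime : p.Prime
  n_ne : n ≠ 0
  val_p : v (p : Ω) = 1
  ρ_pos : 0 < ρ
  ρ_lt : ρ < 1
  a_ne : a ≠ 0
  val_a : v a = ρ * ((p : ℚ) ^ n * (p : ℚ) ^ n - 1)
  c_ne : c ≠ 0
  val_c : v c = 0

/-- The common valuation of the roots of the monodromy polynomial. -/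
def rootVal (p n : ℕ) (ρ : ℚ) : ℚ :=
  ρ * ((p : ℚ) ^ n * (p : ℚ) ^ n - 1) / ((p : ℚ) ^ n * (p : ℚ) ^ n)

section Estimates

variable {Ω : Type*} [Field Ω] {v : Ω → ℚ} {p n : ℕ} {a c : Ω} {ρ : ℚ}

/-- The mixed terms in the binomial expansion of a `p`-power are divisible by `p`. -/
lemma IsExpVal.le_binomial (hv : IsExpVal v) (hp : p.Prime) (hvp : v (p : Ω) = 1) (m : ℕ)
    {x δ : Ω} {r s d : ℚ} (hx : LeVal v s x) (hδ : LeVal v d δ)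
    (hr : ∀ k : ℕ, 0 < k → k < p ^ m → r ≤ 1 + k * s + ((p : ℚ) ^ m - k) * d) :
    LeVal v r ((x + δ) ^ p ^ m - x ^ p ^ m - δ ^ p ^ m) := by
  rw [add_pow_prime_pow_eq' hp, sub_sub, add_sub_cancel_left, Finset.mul_sum]
  refine hv.le_sum _ _ fun k hk => ?_
  obtain ⟨hk0, hk1⟩ := Finset.mem_Ioo.mp hk
  have h1 := hv.le_mul (Or.inr hvp.ge : LeVal v 1 (p : Ω))
    (hv.le_mul (hv.le_mul (hv.le_pow hx k) (hv.le_pow hδ (p ^ m - k)))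
      (hv.le_natCast ((p ^ m).choose k / p)))
  refine h1.mono ((hr k hk0 hk1).trans_eq ?_)
  rw [Nat.cast_sub hk1.le]
  push_cast
  ring

lemma IsExpVal.le_pow_sub_pow (hv : IsExpVal v) {A B : Ω} {r : ℚ} (hA : LeVal v 0 A)
    (hB : LeVal v 0 B) (h : LeVal v r (A - B)) (m : ℕ) : LeVal v r (A ^ m - B ^ m) := by
  rw [← (Commute.all A B).geom_sum₂_mul]
  have : LeVal v 0 (∑ i ∈ Finset.range m, A ^ i * B ^ (m - 1 - i)) :=
    hv.le_sum _ _ fun i _ => by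
      simpa using hv.le_mul (hv.le_pow_zero hA i) (hv.le_pow_zero hB (m - 1 - i))
  simpa using hv.le_mul this h

namespace IsMonodromyDatum

variable (D : IsMonodromyDatum v p n a c ρ)
include D

lemma two_le_q : (2 : ℚ) ≤ (p : ℚ) ^ n := by
  have h1 : 2 ^ 1 ≤ p ^ n :=
    (Nat.pow_le_pow_left D.prime.two_le 1).trans
      (Nat.pow_le_pow_right D.prime.pos (Nat.one_le_iff_ne_zero.mpr D.n_ne))
  exact_mod_cast h1

lemma four_le_qq : (4 : ℚ) ≤ (p : ℚ) ^ n * (p : ℚ) ^ n := by nlinarith [D.two_le_q]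

lemma qq_mul_rootVal :
    (p : ℚ) ^ n * (p : ℚ) ^ n * rootVal p n ρ = ρ * ((p : ℚ) ^ n * (p : ℚ) ^ n - 1) := by
  have := D.four_le_qq
  rw [rootVal, mul_div_cancel₀]
  positivity

lemma rootVal_pos : 0 < rootVal p n ρ := by
  have := D.four_le_qq
  have := D.ρ_pos
  exact div_pos (mul_pos this (by linarith)) (by linarith)

lemma rootVal_lt : rootVal p n ρ < ρ := by
  nlinarith [D.four_le_qq, D.ρ_pos, D.qq_mul_rootVal]

lemma rootVal_lt_one : rootVal p n ρ < 1 := D.rootVal_lt.trans D.ρ_lt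

lemma le_c : LeVal v 0 c := Or.inr D.val_c.ge

lemma f_sub_one {x : Ω} {s : ℚ} (hs : 0 < s) (hx : LeVal v s x) :
    LeVal v ((p : ℚ) ^ n * s) (1 + c * x ^ p ^ n + x ^ (p ^ n + 1) - 1) := by
  have hv := D.val
  have e : 1 + c * x ^ p ^ n + x ^ (p ^ n + 1) - 1 = c * x ^ p ^ n + x ^ (p ^ n + 1) := by ring
  have h1 := hv.le_pow hx (p ^ n)
  have h2 := hv.le_pow hx (p ^ n + 1)
  push_cast at h1 h2
  rw [e]
  exact hv.le_add ((hv.le_mul D.le_c h1).mono (by simp)) (h2.mono (by linarith))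

lemma le_f {x : Ω} {s : ℚ} (hs : 0 < s) (hx : LeVal v s x) :
    LeVal v 0 (1 + c * x ^ p ^ n + x ^ (p ^ n + 1)) := by
  have := D.val.le_add ((D.f_sub_one hs hx).mono (by positivity)) D.val.le_one
  rwa [sub_add_cancel] at this

lemma pow_diff {x δ : Ω} {s d : ℚ} (hs : 0 < s) (hsd : s ≤ d) (hx : LeVal v s x)
    (hδ : LeVal v d δ) : LeVal v (d + s) ((x + δ) ^ p ^ n - x ^ p ^ n) := by
  have hv := D.val
  have h1 : LeVal v (d + s) ((x + δ) ^ p ^ n - x ^ p ^ n - δ ^ p ^ n) := by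
    refine hv.le_binomial D.prime D.val_p n hx hδ fun k hk0 hk1 => ?_
    have hk0' : (1 : ℚ) ≤ k := by exact_mod_cast hk0
    have hk1' : (k : ℚ) + 1 ≤ (p : ℚ) ^ n := by exact_mod_cast hk1
    nlinarith
  have h2 := hv.le_pow hδ (p ^ n)
  have h3 : LeVal v (d + s) (δ ^ p ^ n) := h2.mono (by push_cast; nlinarith [D.two_le_q])
  have := hv.le_add h1 h3
  rwa [sub_add_cancel] at this

lemma f_diff {x δ : Ω} {s d : ℚ} (hs : 0 < s) (hsd : s ≤ d) (hx : LeVal v s x)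
    (hδ : LeVal v d δ) :
    LeVal v (d + s) ((1 + c * (x + δ) ^ p ^ n + (x + δ) ^ (p ^ n + 1)) -
      (1 + c * x ^ p ^ n + x ^ (p ^ n + 1))) := by
  have hv := D.val
  have e : (1 + c * (x + δ) ^ p ^ n + (x + δ) ^ (p ^ n + 1)) -
      (1 + c * x ^ p ^ n + x ^ (p ^ n + 1)) =
      (c + (x + δ)) * ((x + δ) ^ p ^ n - x ^ p ^ n) + δ * x ^ p ^ n := by ring
  rw [e]
  refine hv.le_add ?_ ?_
  · have h1 := D.pow_diff hs hsd hx hδ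
    have h2 : LeVal v 0 (c + (x + δ)) :=
      hv.le_add D.le_c (hv.le_add (hx.mono hs.le) (hδ.mono (hs.le.trans hsd)))
    simpa using hv.le_mul h2 h1
  · have h1 := hv.le_pow hx (p ^ n)
    exact hv.le_mul hδ (h1.mono (by push_cast; nlinarith [D.two_le_q]))

lemma linear_part {x δ : Ω} {s d : ℚ} (hs : 0 < s) (hsd : s ≤ d)
    (hx : LeVal v s x) (hδ : LeVal v d δ) (m : ℕ) :
    LeVal v (d + s) ((c + (x + δ)) * (1 + c * (x + δ) ^ p ^ n + (x + δ) ^ (p ^ n + 1)) ^ m -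
      (c + x) * (1 + c * x ^ p ^ n + x ^ (p ^ n + 1)) ^ m - δ) := by
  have hv := D.val
  have hx' : LeVal v s (x + δ) := hv.le_add hx (hδ.mono hsd)
  have h1 := hv.le_pow_sub_pow (D.le_f hs hx') (D.le_f hs hx) (D.f_diff hs hsd hx hδ) m
  have h2 := hv.le_pow_sub_pow (D.le_f hs hx') hv.le_one
    ((D.f_sub_one hs hx').mono (s := s) (by nlinarith [D.two_le_q])) m
  have h3 : LeVal v 0 (c + x) := hv.le_add D.le_c (hx.mono hs.le)
  generalize 1 + c * (x + δ) ^ p ^ n + (x + δ) ^ (p ^ n + 1) = A at *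
  generalize 1 + c * x ^ p ^ n + x ^ (p ^ n + 1) = B at *
  have e : (c + (x + δ)) * A ^ m - (c + x) * B ^ m - δ =
      (c + x) * (A ^ m - B ^ m) + δ * (A ^ m - 1 ^ m) := by ring
  rw [e]
  exact hv.le_add (by simpa using hv.le_mul h3 h1) (hv.le_mul hδ h2)

/-- Additive expansion of the monodromy polynomial around a point of the same valuation as its
roots: up to small error terms it is `δ ^ q² - a δ`. -/
lemma expansion {x δ : Ω} {d : ℚ} (hx : LeVal v (rootVal p n ρ) x) (hd : rootVal p n ρ ≤ d)
    (hδ : LeVal v d δ) :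
    ∃ E₁ E₂ : Ω, monodromyEval (p ^ n) a c (x + δ) - monodromyEval (p ^ n) a c x =
        δ ^ (p ^ n * p ^ n) - a * δ + E₁ - a * E₂ ∧
      (d ≤ ρ → LeVal v ((p : ℚ) ^ n * (p : ℚ) ^ n * d + (1 - ρ)) E₁) ∧
      (ρ ≤ d → LeVal v (v a + d + (1 - ρ)) E₁) ∧
      LeVal v (d + rootVal p n ρ) E₂ := by
  have hv := D.val
  have hE₂ := D.linear_part D.rootVal_pos hd hx hδ (p ^ n - 1)
  refine ⟨(x + δ) ^ (p ^ n * p ^ n) - x ^ (p ^ n * p ^ n) - δ ^ (p ^ n * p ^ n), _, ?_, ?_, ?_,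
    hE₂⟩
  · simp only [monodromyEval]
    ring
  · intro hdρ
    rw [show p ^ n * p ^ n = p ^ (n + n) from (pow_add p n n).symm]
    refine hv.le_binomial D.prime D.val_p (n + n) hx hδ fun k hk0 hk1 => ?_
    have hk1' : (k : ℚ) ≤ (p : ℚ) ^ n * (p : ℚ) ^ n := by
      rw [← pow_add]; exact_mod_cast hk1.le
    rw [pow_add]
    nlinarith [D.qq_mul_rootVal, D.rootVal_lt,
      mul_nonneg (Nat.cast_nonneg (α := ℚ) k) (sub_nonneg.mpr hdρ),
      mul_nonneg (sub_nonneg.mpr hk1') (sub_nonneg.mpr D.rootVal_lt.le)]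
  · intro hdρ
    rw [show p ^ n * p ^ n = p ^ (n + n) from (pow_add p n n).symm]
    refine hv.le_binomial D.prime D.val_p (n + n) hx hδ fun k hk0 hk1 => ?_
    have hk1' : (k : ℚ) + 1 ≤ (p : ℚ) ^ n * (p : ℚ) ^ n := by
      rw [← pow_add]; exact_mod_cast hk1
    rw [pow_add, D.val_a]
    nlinarith [D.qq_mul_rootVal, D.rootVal_lt,
      mul_nonneg (sub_nonneg.mpr hk1') (sub_nonneg.mpr hdρ),
      mul_nonneg (sub_nonneg.mpr hk1') (sub_nonneg.mpr D.rootVal_lt.le)]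

lemma root_val {y : Ω} (hy : monodromyEval (p ^ n) a c y = 0) :
    y ≠ 0 ∧ v y = rootVal p n ρ := by
  have hv := D.val
  have hq2 := D.two_le_q
  have hqq := D.four_le_qq
  have hva : 0 < v a := by rw [D.val_a]; exact mul_pos D.ρ_pos (by linarith)
  have hqn : p ^ n ≠ 0 := (pow_pos D.prime.pos n).ne'
  have hq1 : 1 ≤ p ^ n := Nat.one_le_iff_ne_zero.mpr hqn
  rw [monodromyEval, sub_eq_zero] at hy
  have hy0 : y ≠ 0 := by
    rintro rfl
    rw [zero_pow (mul_ne_zero hqn hqn), zero_pow hqn, zero_pow (Nat.succ_ne_zero _)] at hy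
    simp [D.a_ne, D.c_ne] at hy
  have hypow : y ^ (p ^ n * p ^ n) ≠ 0 := pow_ne_zero _ hy0
  have hvpow : v (y ^ (p ^ n * p ^ n)) = (p : ℚ) ^ n * (p : ℚ) ^ n * v y := by
    rw [hv.map_pow hy0]; push_cast; ring
  refine ⟨hy0, ?_⟩
  have hnonneg : 0 ≤ v y := by
    by_contra hneg
    push Not at hneg
    have h1 : LeVal v (v y) (c + y) := hv.le_add (D.le_c.mono hneg.le) (LeVal.self y)
    have h2 : LeVal v (((p : ℚ) ^ n + 1) * v y) (1 + c * y ^ p ^ n + y ^ (p ^ n + 1)) := by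
      have h3 := hv.le_pow (LeVal.self (v := v) y) (p ^ n)
      have h4 := hv.le_pow (LeVal.self (v := v) y) (p ^ n + 1)
      push_cast at h3 h4
      exact hv.le_add (hv.le_add (hv.le_one.mono (by nlinarith))
        ((hv.le_mul D.le_c h3).mono (by linarith))) h4
    have h5 := (hv.le_mul (hv.le_mul (LeVal.self a) h1) (hv.le_pow h2 (p ^ n - 1)))
    rw [← hy] at h5
    have h6 := h5.le_val hypow
    rw [hvpow, Nat.cast_sub hq1] at h6
    push_cast at h6
    nlinarith
  have hpos : 0 < v y := by
    have h0 : LeVal v 0 y := Or.inr hnonneg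
    have h1 : LeVal v 0 (c + y) := hv.le_add D.le_c h0
    have h2 : LeVal v 0 (1 + c * y ^ p ^ n + y ^ (p ^ n + 1)) :=
      hv.le_add (hv.le_add hv.le_one (by simpa using hv.le_mul D.le_c (hv.le_pow_zero h0 (p ^ n))))
        (hv.le_pow_zero h0 _)
    have h5 := (hv.le_mul (hv.le_mul (LeVal.self a) h1) (hv.le_pow_zero h2 (p ^ n - 1)))
    rw [← hy] at h5
    have h6 := h5.le_val hypow
    rw [hvpow] at h6
    by_contra hle
    nlinarith
  obtain ⟨h1, h2⟩ := hv.add_dominant D.c_ne (y := y) (Or.inr (by rwa [D.val_c]))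
  have h3 := D.f_sub_one hpos (LeVal.self y)
  obtain ⟨h4, h5⟩ := hv.add_dominant one_ne_zero
    (h3.lt (s := v 1) (by rw [hv.map_one]; positivity))
  rw [add_sub_cancel] at h4 h5
  have h6 := congrArg v hy
  rw [hvpow, hv.mul _ _ (mul_ne_zero D.a_ne h1) (pow_ne_zero _ h4), hv.mul _ _ D.a_ne h1,
    hv.map_pow h4, h5, h2, hv.map_one, D.val_c, D.val_a, mul_zero, add_zero, add_zero] at h6
  rw [rootVal, eq_div_iff (by positivity), ← h6]
  ring

lemma root_diff_le {y y' : Ω} (hy : monodromyEval (p ^ n) a c y = 0)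
    (hy' : monodromyEval (p ^ n) a c y' = 0) : LeVal v ρ (y' - y) := by
  have hv := D.val
  have hqq := D.four_le_qq
  by_cases h0 : y' - y = 0
  · exact Or.inl h0
  by_contra hcon
  have hlt : v (y' - y) < ρ := not_le.mp fun h => hcon (Or.inr h)
  have hyv : LeVal v (rootVal p n ρ) y := Or.inr (D.root_val hy).2.ge
  have hyv' : LeVal v (rootVal p n ρ) y' := Or.inr (D.root_val hy').2.ge
  obtain ⟨E₁, E₂, he, h1, -, h2⟩ := D.expansion hyv ((hv.le_sub hyv' hyv).le_val h0)
    (LeVal.self (y' - y))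
  rw [add_sub_cancel, hy, hy', sub_zero] at he
  generalize y' - y = δ at *
  apply pow_ne_zero (p ^ n * p ^ n) h0
  refine eq_zero_of_ltVal_self (v := v) ?_
  rw [hv.map_pow h0]
  have e : δ ^ (p ^ n * p ^ n) = a * δ - E₁ + a * E₂ := by linear_combination -he
  have hρ := D.ρ_lt
  have hr := D.rootVal_pos
  rw [e]
  have key : ((p ^ n * p ^ n : ℕ) : ℚ) * v δ < v a + v δ := by
    rw [D.val_a]; push_cast; nlinarith
  refine hv.lt_add (hv.lt_sub ?_ ((h1 hlt.le).lt ?_)) ?_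
  · exact (hv.le_mul (LeVal.self a) (LeVal.self δ)).lt key
  · push_cast; linarith
  · exact (hv.le_mul (LeVal.self a) h2).lt (by linarith)

lemma root_unique {y y' : Ω} (hy : monodromyEval (p ^ n) a c y = 0)
    (hy' : monodromyEval (p ^ n) a c y' = 0) (h : LtVal v ρ (y' - y)) : y' = y := by
  have hv := D.val
  have hqq := D.four_le_qq
  by_contra hne
  have h0 : y' - y ≠ 0 := sub_ne_zero.mpr hne
  have hlt := h.lt_val h0
  have hyv : LeVal v (rootVal p n ρ) y := Or.inr (D.root_val hy).2.ge
  obtain ⟨E₁, E₂, he, -, h1, h2⟩ := D.expansion hyv (D.rootVal_lt.le.trans hlt.le)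
    (LeVal.self (y' - y))
  rw [add_sub_cancel, hy, hy', sub_zero] at he
  generalize y' - y = δ at *
  apply mul_ne_zero D.a_ne h0
  refine eq_zero_of_ltVal_self (v := v) ?_
  rw [hv.mul _ _ D.a_ne h0]
  have e : a * δ = δ ^ (p ^ n * p ^ n) + E₁ - a * E₂ := by linear_combination he
  have hρ := D.ρ_lt
  have hr := D.rootVal_pos
  rw [e]
  refine hv.lt_sub (hv.lt_add ?_ ((h1 hlt.le).lt (by linarith))) ?_
  · refine (hv.le_pow (LeVal.self δ) (p ^ n * p ^ n)).lt ?_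
    rw [D.val_a]; push_cast; nlinarith
  · exact (hv.le_mul (LeVal.self a) h2).lt (by linarith)

/-- One step of the iteration `x ↦ x + L(x) / a`, which converges to the root `y`. -/
lemma improve {x y : Ω} (hy : monodromyEval (p ^ n) a c y = 0) {d ε : ℚ} (hρd : ρ ≤ d)
    (h : LeVal v d (y - x)) (h1 : ε ≤ 1 - ρ) (h2 : ε ≤ rootVal p n ρ) (h3 : ε ≤ d - ρ) :
    LeVal v (d + ε) (y - (x + monodromyEval (p ^ n) a c x / a)) := by
  have hv := D.val
  have hqq := D.four_le_qq
  have hrd := D.rootVal_lt.le.trans hρd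
  have hyv : LeVal v (rootVal p n ρ) y := Or.inr (D.root_val hy).2.ge
  have hxv : LeVal v (rootVal p n ρ) x := by
    have := hv.le_sub hyv (h.mono hrd)
    rwa [sub_sub_cancel] at this
  obtain ⟨E₁, E₂, he, -, hE₁, hE₂⟩ := D.expansion hxv hrd h
  rw [add_sub_cancel, hy, zero_sub] at he
  have e : y - (x + monodromyEval (p ^ n) a c x / a) =
      (y - x) ^ (p ^ n * p ^ n) / a + E₁ / a - E₂ := by
    rw [← neg_neg (monodromyEval (p ^ n) a c x), he]
    field_simp [D.a_ne]
    ring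
  rw [e]
  refine hv.le_sub (hv.le_add ?_ ?_) (hE₂.mono (by linarith))
  · refine (hv.le_div (hv.le_pow h _) D.a_ne).mono ?_
    rw [D.val_a]; push_cast; nlinarith
  · exact (hv.le_div (hE₁ hρd) D.a_ne).mono (by linarith)

/-- The normalized differences of roots satisfy `t ^ q² = u t` in the residue field. -/
lemma residue_equation {y y' η : Ω} (hy : monodromyEval (p ^ n) a c y = 0)
    (hy' : monodromyEval (p ^ n) a c y' = 0) (hη0 : η ≠ 0) (hη : v η = ρ) :
    LtVal v 0 (((y' - y) / η) ^ (p ^ n * p ^ n) -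
      a / η ^ (p ^ n * p ^ n - 1) * ((y' - y) / η)) := by
  have hv := D.val
  have hyv : LeVal v (rootVal p n ρ) y := Or.inr (D.root_val hy).2.ge
  have hδ := D.root_diff_le hy hy'
  obtain ⟨E₁, E₂, he, h1, -, h2⟩ := D.expansion hyv D.rootVal_lt.le hδ
  rw [add_sub_cancel, hy, hy', sub_zero] at he
  have hQ : p ^ n * p ^ n ≠ 0 := mul_ne_zero (pow_pos D.prime.pos n).ne' (pow_pos D.prime.pos n).ne'
  obtain ⟨m, hm⟩ := Nat.exists_eq_succ_of_ne_zero hQ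
  have e : ((y' - y) / η) ^ (p ^ n * p ^ n) - a / η ^ (p ^ n * p ^ n - 1) * ((y' - y) / η) =
      (a * E₂ - E₁) / η ^ (p ^ n * p ^ n) := by
    have : a * E₂ - E₁ = (y' - y) ^ (p ^ n * p ^ n) - a * (y' - y) := by linear_combination he
    rw [this, hm, Nat.succ_eq_add_one, Nat.add_sub_cancel, div_pow]
    field_simp
    ring
  have hρ := D.ρ_lt
  have hr := D.rootVal_pos
  have h3 : LtVal v (v (η ^ (p ^ n * p ^ n))) (a * E₂ - E₁) := by
    rw [hv.map_pow hη0, hη]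
    refine hv.lt_sub ((hv.le_mul (LeVal.self a) h2).lt ?_) ((h1 le_rfl).lt ?_)
    · rw [D.val_a]; push_cast; linarith
    · push_cast; linarith
  rw [e]
  have := hv.lt_div h3 (pow_ne_zero (p ^ n * p ^ n) hη0)
  rwa [sub_self] at this

/-- An element of `K(y)` which generates the wild ramification. -/
lemma exists_wild {y b : Ω} (hy : monodromyEval (p ^ n) a c y = 0) (hb : b ^ p = a)
    (hc : LeVal v 1 (c ^ p - c)) {m : ℕ} (hm : m * p = p ^ n * p ^ n) :
    y ^ m / b - c ≠ 0 ∧ v (y ^ m / b - c) = rootVal p n ρ / p := by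
  have hv := D.val
  obtain ⟨hy0, hyv⟩ := D.root_val hy
  have hyle : LeVal v (rootVal p n ρ) y := Or.inr hyv.ge
  have hr := D.rootVal_pos
  have hr1 := D.rootVal_lt_one
  have hp0 : (0 : ℚ) < p := by exact_mod_cast D.prime.pos
  set f := 1 + c * y ^ p ^ n + y ^ (p ^ n + 1) with hf
  set g := f ^ (p ^ n - 1) with hg
  have hb0 : b ≠ 0 := by
    rintro rfl
    exact D.a_ne (by rw [← hb, zero_pow D.prime.ne_zero])
  have hs : (y ^ m / b) ^ p = (c + y) * g := by
    rw [div_pow, ← pow_mul, hm, hb, div_eq_iff D.a_ne]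
    rw [monodromyEval] at hy
    linear_combination hy
  have hfle := D.le_f hr hyle
  have hgle : LeVal v 0 g := hv.le_pow_zero hfle _
  have hcyle : LeVal v 0 (c + y) := hv.le_add D.le_c (hyle.mono hr.le)
  have hg1 : LeVal v ((p : ℚ) ^ n * rootVal p n ρ) (g - 1) := by
    have := hv.le_pow_sub_pow hfle hv.le_one (D.f_sub_one hr hyle) (p ^ n - 1)
    rwa [one_pow] at this
  have hsle : LeVal v 0 (y ^ m / b) := by
    refine hv.le_pow_imp D.prime.ne_zero ?_
    rw [mul_zero, hs]
    simpa using hv.le_mul hcyle hgle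
  set z := y ^ m / b - c with hz
  have hzle : LeVal v 0 z := hv.le_sub hsle D.le_c
  have hbin : LeVal v 1 ((c + z) ^ p - c ^ p - z ^ p) := by
    have := hv.le_binomial (r := 1) D.prime D.val_p 1 D.le_c hzle (by simp)
    rwa [pow_one] at this
  have hcz : c + z = y ^ m / b := by rw [hz]; ring
  have e : z ^ p = y + (-(c ^ p - c) + (c + y) * (g - 1) - ((c + z) ^ p - c ^ p - z ^ p)) := by
    rw [hcz, hs]; ring
  have hsmall : LtVal v (v y) (-(c ^ p - c) + (c + y) * (g - 1) -
      ((c + z) ^ p - c ^ p - z ^ p)) := by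
    rw [hyv]
    refine hv.lt_sub (hv.lt_add (hv.lt_neg (hc.lt hr1)) ?_) (hbin.lt hr1)
    refine (hv.le_mul hcyle hg1).lt ?_
    nlinarith [D.two_le_q]
  obtain ⟨h1, h2⟩ := hv.add_dominant hy0 hsmall
  rw [← e] at h1 h2
  have hz0 : z ≠ 0 := fun h0 => h1 (by rw [h0, zero_pow D.prime.ne_zero])
  refine ⟨hz0, ?_⟩
  rw [hv.map_pow hz0, hyv] at h2
  rw [eq_div_iff hp0.ne', ← h2]
  ring

end IsMonodromyDatum

end Estimates

lemma nonempty_linearEquiv_of_card {A : Type*} [AddCommGroup A] {p m : ℕ} [Fact p.Prime]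
    [Module (ZMod p) A] (hcard : Nat.card A = p ^ m) :
    Nonempty (A ≃ₗ[ZMod p] (Fin m → ZMod p)) := by
  have hp := (Fact.out : p.Prime)
  have : Finite A := Nat.finite_of_card_ne_zero (by rw [hcard]; exact pow_ne_zero _ hp.ne_zero)
  have hfin : Module.Finite (ZMod p) A := Module.Finite.of_finite
  have hrank : Module.finrank (ZMod p) A = m := by
    have h1 := FiniteField.pow_finrank_eq_natCard p A
    rw [hcard] at h1
    exact Nat.pow_right_injective hp.two_le h1
  exact ⟨LinearEquiv.ofFinrankEq A (Fin m → ZMod p) (by rw [hrank, Module.finrank_fin_fun])⟩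

/-- A finite commutative group of exponent `p` and order `p ^ m` is elementary abelian of
rank `m`. -/
lemma nonempty_mulEquiv_of_pow_eq_one {G : Type*} [Group G] {p m : ℕ} [Fact p.Prime]
    (hcomm : ∀ g h : G, g * h = h * g) (hpow : ∀ g : G, g ^ p = 1) (hcard : Nat.card G = p ^ m) :
    Nonempty (G ≃* Multiplicative (Fin m → ZMod p)) := by
  let _ : CommGroup G := { (inferInstance : Group G) with mul_comm := hcomm }
  let _ : Module (ZMod p) (Additive G) :=
    AddCommGroup.zmodModule (fun x => congrArg Additive.ofMul (hpow x.toMul))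
  obtain ⟨e⟩ := nonempty_linearEquiv_of_card (A := Additive G) (p := p) (m := m) hcard
  exact ⟨MulEquiv.toAdditiveLeft.symm e.toAddEquiv⟩

section Galois

variable {p n : ℕ} {W k K₀ Ω : Type*} [CommRing W] [Field k] [Field K₀] [Field Ω] [Algebra W K₀]
  [Algebra K₀ Ω] [Algebra W Ω] {v : Ω → ℚ} {ρ : ℚ} {N : ℕ}

lemma algebraMap_monodromyEval {F : Type*} [Field F] [Algebra F Ω] (q : ℕ) (a c x : F) :
    algebraMap F Ω (monodromyEval q a c x) =
      monodromyEval q (algebraMap F Ω a) (algebraMap F Ω c) (algebraMap F Ω x) := by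
  simp [monodromyEval]

variable {K : Type*} [Field K] [Algebra K₀ K] [Algebra K Ω] [IsScalarTower K₀ K Ω]
  [FiniteDimensional K₀ K] {e : ℕ}

instance isScalarTower_base_intermediateField (F : IntermediateField K Ω) :
    IsScalarTower K₀ F Ω :=
  IsScalarTower.of_algebraMap_eq fun _ => rfl

/-- A root of the monodromy polynomial generates a totally ramified extension of full degree. -/
lemma IsMonodromyDatum.exists_uniformizer {a b c μ : K} {y : Ω}
    (D : IsMonodromyDatum v p n (algebraMap K Ω a) (algebraMap K Ω c) (p / e))
    (h : IsPadicBase p W K₀ v) (he : e ≠ 0) (hK : Module.finrank K₀ K ≤ e) (hb : b ^ p = a)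
    (hc : LeVal v 1 (algebraMap K Ω c ^ p - algebraMap K Ω c)) (hμ0 : μ ≠ 0)
    (hμ : v (algebraMap K Ω μ) = 1 / e) {L : K[X]} (hL0 : L ≠ 0)
    (hLdeg : L.natDegree ≤ p ^ n * p ^ n) (hLy : aeval y L = 0)
    (hy : monodromyEval (p ^ n) (algebraMap K Ω a) (algebraMap K Ω c) y = 0) :
    FiniteDimensional K₀ (IntermediateField.adjoin K {y}) ∧
    Module.finrank K₀ (IntermediateField.adjoin K {y}) ≤ e * (p ^ n * p ^ n) ∧
    Module.finrank K (IntermediateField.adjoin K {y}) = p ^ (2 * n) ∧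
    ∃ π : IntermediateField.adjoin K {y}, π ≠ 0 ∧
      v (algebraMap _ Ω π) = 1 / (e * (p ^ n * p ^ n) : ℕ) := by
  have hv := D.val
  have hint : IsIntegral K y := ⟨L * C L.leadingCoeff⁻¹, monic_mul_leadingCoeff_inv hL0, by
    rw [← aeval_def, map_mul, hLy, zero_mul]⟩
  have hfin : FiniteDimensional K (IntermediateField.adjoin K {y}) :=
    IntermediateField.adjoin.finiteDimensional hint
  have hfin₀ : FiniteDimensional K₀ (IntermediateField.adjoin K {y}) :=
    FiniteDimensional.trans K₀ K _
  have hdeg : Module.finrank K (IntermediateField.adjoin K {y}) ≤ p ^ n * p ^ n := by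
    rw [IntermediateField.adjoin.finrank hint]
    exact (natDegree_le_of_dvd (minpoly.dvd K y hLy) hL0).trans hLdeg
  have hmul := Module.finrank_mul_finrank K₀ K (IntermediateField.adjoin K {y})
  have hle : Module.finrank K₀ (IntermediateField.adjoin K {y}) ≤ e * (p ^ n * p ^ n) := by
    rw [← hmul]
    exact Nat.mul_le_mul hK hdeg
  have hQpos : 0 < p ^ n * p ^ n := by have := D.prime.pos; positivity
  have hN : e * (p ^ n * p ^ n) ≠ 0 := mul_ne_zero he hQpos.ne'
  have hm : p ^ (2 * n - 1) * p = p ^ n * p ^ n := by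
    rw [← pow_succ, Nat.sub_add_cancel (by have := Nat.pos_of_ne_zero D.n_ne; omega), two_mul,
      pow_add]
  obtain ⟨hw0, hw⟩ := D.exists_wild hy (b := algebraMap K Ω b) (by rw [← map_pow, hb]) hc hm
  let y₁ : IntermediateField.adjoin K {y} := IntermediateField.AdjoinSimple.gen K y
  let π : IntermediateField.adjoin K {y} := algebraMap K _ μ /
    (y₁ ^ p ^ (2 * n - 1) / algebraMap K _ b - algebraMap K _ c)
  have hπΩ : algebraMap _ Ω π = algebraMap K Ω μ /
      (y ^ p ^ (2 * n - 1) / algebraMap K Ω b - algebraMap K Ω c) := by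
    simp [π, y₁, ← IsScalarTower.algebraMap_apply]
  have hμ0' : algebraMap K Ω μ ≠ 0 := by simpa using hμ0
  have hπ0Ω : algebraMap _ Ω π ≠ 0 := by
    rw [hπΩ]
    exact div_ne_zero hμ0' hw0
  have hπ0 : π ≠ 0 := fun h0 => hπ0Ω (by rw [h0, map_zero])
  have hπ : v (algebraMap _ Ω π) = 1 / (e * (p ^ n * p ^ n) : ℕ) := by
    have hp0 : (p : ℚ) ≠ 0 := by exact_mod_cast D.prime.ne_zero
    have he0 : (e : ℚ) ≠ 0 := by exact_mod_cast he
    rw [hπΩ, hv.map_div hμ0' hw0, hμ, hw, rootVal]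
    push_cast
    field_simp
    ring
  refine ⟨hfin₀, hle, ?_, π, hπ0, hπ⟩
  have hli := (h.linearIndependent hN hπ0 hπ).fintype_card_le_finrank
  rw [Fintype.card_fin, ← hmul] at hli
  rw [two_mul, pow_add]
  refine le_antisymm hdeg (Nat.le_of_mul_le_mul_left (hli.trans ?_) (Nat.pos_of_ne_zero he))
  exact Nat.mul_le_mul_right _ hK

variable [IsScalarTower W K₀ Ω]

/-- A field which is totally ramified over the base, and which contains one root of the monodromy
polynomial and an element whose valuation is that of the differences of roots, contains all the
roots. -/
lemma IsMonodromyDatum.mem_range_of_root [IsAlgClosed k] {F : Type*} [Field F] [Algebra K₀ F]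
    [Algebra F Ω] [IsScalarTower K₀ F Ω] [FiniteDimensional K₀ F]
    [IsAdicComplete (Ideal.span {(p : W)}) W]
    {a c η y π : F} (D : IsMonodromyDatum v p n (algebraMap F Ω a) (algebraMap F Ω c) ρ)
    (h : IsPadicBase p W K₀ v) (hN : N ≠ 0) (hπ0 : π ≠ 0) (hπ : v (algebraMap F Ω π) = 1 / N)
    (hF : Module.finrank K₀ F ≤ N)
    (φ : W →+* k) (hφ : Function.Surjective φ) (hker : RingHom.ker φ = Ideal.span {(p : W)})
    (hη0 : η ≠ 0) (hη : v (algebraMap F Ω η) = ρ) (hp0 : (p : Ω) ≠ 0)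
    (hy : monodromyEval (p ^ n) a c y = 0) {y' : Ω}
    (hy' : monodromyEval (p ^ n) (algebraMap F Ω a) (algebraMap F Ω c) y' = 0) :
    ∃ x : F, algebraMap F Ω x = y' := by
  have hv := D.val
  have hyΩ : monodromyEval (p ^ n) (algebraMap F Ω a) (algebraMap F Ω c)
      (algebraMap F Ω y) = 0 := by
    rw [← algebraMap_monodromyEval, hy, map_zero]
  have hη0' : algebraMap F Ω η ≠ 0 := by simpa using hη0
  have ha0 := D.a_ne
  have hQ : (1 : ℕ) < p ^ n * p ^ n := by
    have := D.four_le_qq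
    have h4 : 4 ≤ p ^ n * p ^ n := by exact_mod_cast this
    omega
  set Q := p ^ n * p ^ n with hQdef
  have hQc : ((Q - 1 : ℕ) : ℚ) = (p : ℚ) ^ n * (p : ℚ) ^ n - 1 := by
    rw [Nat.cast_sub hQ.le, hQdef]; push_cast; ring
  set t := (y' - algebraMap F Ω y) / algebraMap F Ω η with ht
  have htv : LeVal v 0 t := by
    have := hv.le_div (D.root_diff_le hyΩ hy') hη0'
    rwa [hη, sub_self] at this
  have hres := D.residue_equation hyΩ hy' hη0' hη
  rw [← ht, ← hQdef] at hres
  have hu : v (algebraMap F Ω (a / η ^ (Q - 1))) = 0 := by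
    rw [map_div₀, map_pow, hv.map_div ha0 (pow_ne_zero _ hη0'), hv.map_pow hη0', D.val_a, hη, hQc]
    ring
  obtain ⟨u, hu'⟩ := h.exists_residue hN hπ0 hπ hF _ (Or.inr hu.ge)
  have hpv : LtVal v 0 (p : Ω) := Or.inr (by rw [D.val_p]; exact one_pos)
  obtain ⟨w, hw⟩ := hv.exists_near_of_eval_lt hpv h.le_base φ hφ hker (X ^ Q - C u * X)
    (monic_X_pow_sub ((degree_C_mul_X_le u).trans_lt (by exact_mod_cast hQ))) t htv (by
      have : aeval t (X ^ Q - C u * X) = t ^ Q - algebraMap F Ω a / algebraMap F Ω η ^ (Q - 1) * t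
          + (algebraMap F Ω (a / η ^ (Q - 1)) - algebraMap W Ω u) * t := by
        simp only [map_sub, map_mul, map_pow, aeval_X, aeval_C, map_div₀]; ring
      rw [this]
      refine hv.lt_add hres ?_
      simpa using hv.lt_mul_le hu' htv)
  set x₀ : F := y + η * algebraMap K₀ F (algebraMap W K₀ w) with hx₀
  have hx₀Ω : y' - algebraMap F Ω x₀ = algebraMap F Ω η * (t - algebraMap W Ω w) := by
    rw [hx₀, map_add, map_mul, ← IsScalarTower.algebraMap_apply K₀ F Ω,
      ← IsScalarTower.algebraMap_apply W K₀ Ω, ht]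
    field_simp
    ring
  have hx₀v : LtVal v ρ (y' - algebraMap F Ω x₀) := by
    rw [hx₀Ω, mul_comm]
    have := hv.lt_mul_le hw (LeVal.self (v := v) (algebraMap F Ω η))
    rwa [hη, zero_add] at this
  by_cases hne : y' - algebraMap F Ω x₀ = 0
  · exact ⟨x₀, (sub_eq_zero.mp hne).symm⟩
  set d := v (y' - algebraMap F Ω x₀) with hd
  have hρd : ρ < d := hx₀v.lt_val hne
  set ε := min (min (1 - ρ) (rootVal p n ρ)) (d - ρ) with hε
  have hεpos : 0 < ε :=
    lt_min (lt_min (sub_pos.mpr D.ρ_lt) D.rootVal_pos) (sub_pos.mpr hρd)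
  have hiter : ∀ j : ℕ, ∃ x : F, LeVal v (d + j * ε) (y' - algebraMap F Ω x) := by
    intro j
    induction j with
    | zero => exact ⟨x₀, by simpa using LeVal.self _⟩
    | succ j ih =>
      obtain ⟨x, hx⟩ := ih
      have hj : 0 ≤ j * ε := by positivity
      refine ⟨x + monodromyEval (p ^ n) a c x / a, ?_⟩
      have := D.improve hy' (d := d + j * ε) (ε := ε) (by linarith) hx
        ((min_le_left _ _).trans (min_le_left _ _)) ((min_le_left _ _).trans (min_le_right _ _))
        ((min_le_right _ _).trans (by linarith))
      rw [map_add, map_div₀, algebraMap_monodromyEval]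
      convert this using 1
      push_cast
      ring
  refine h.mem_range_of_approx hN hπ0 hπ hF hp0 y' fun j => ?_
  obtain ⟨m, hm⟩ := exists_nat_ge (j / ε)
  obtain ⟨x, hx⟩ := hiter m
  refine ⟨x, hx.mono ?_⟩
  have := (div_le_iff₀ hεpos).mp hm
  linarith [D.ρ_pos]

/-- The automorphisms of a totally ramified field act trivially on the quotient of a difference of
roots of the monodromy polynomial by an invariant element of the same valuation. -/
lemma IsMonodromyDatum.aut_diff_lt {F : Type*} [Field F] [Algebra K₀ F]
    [Algebra F Ω] [IsScalarTower K₀ F Ω] [FiniteDimensional K₀ F]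
    {a c η y y' π : F} (D : IsMonodromyDatum v p n (algebraMap F Ω a) (algebraMap F Ω c) ρ)
    (h : IsPadicBase p W K₀ v) (hN : N ≠ 0) (hπ0 : π ≠ 0) (hπ : v (algebraMap F Ω π) = 1 / N)
    (hF : Module.finrank K₀ F ≤ N) (hη0 : η ≠ 0) (hη : v (algebraMap F Ω η) = ρ)
    (hy : monodromyEval (p ^ n) a c y = 0) (hy' : monodromyEval (p ^ n) a c y' = 0)
    (τ : F ≃ₐ[K₀] F) (hτ : τ η = η) :
    LtVal v ρ (algebraMap F Ω (τ y' - τ y - (y' - y))) := by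
  have hv := D.val
  have hη0' : algebraMap F Ω η ≠ 0 := by simpa using hη0
  have hroot : ∀ x : F, monodromyEval (p ^ n) a c x = 0 →
      monodromyEval (p ^ n) (algebraMap F Ω a) (algebraMap F Ω c) (algebraMap F Ω x) = 0 :=
    fun x hx => by rw [← algebraMap_monodromyEval, hx, map_zero]
  have ht : LeVal v 0 (algebraMap F Ω ((y' - y) / η)) := by
    have := hv.le_div (D.root_diff_le (hroot y hy) (hroot y' hy')) hη0'
    rwa [hη, sub_self, ← map_sub, ← map_div₀] at this
  have hlt := hv.lt_mul_le (h.aut_sub_lt hN hπ0 hπ hF τ _ ht)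
    (LeVal.self (v := v) (algebraMap F Ω η))
  rw [hη, zero_add, map_div₀ τ, hτ, map_sub τ, ← map_sub, ← map_mul, sub_mul, div_mul_cancel₀ _ hη0,
    div_mul_cancel₀ _ hη0] at hlt
  exact hlt

/-- The Galois group of the extension generated by a root of the monodromy polynomial is elementary
abelian. -/
theorem IsMonodromyDatum.isGalois_adjoin [Fact p.Prime] [IsAlgClosed k] [CharZero Ω] [Normal K Ω]
    [IsAdicComplete (Ideal.span {(p : W)}) W] {a b c μ : K} {y : Ω}
    (D : IsMonodromyDatum v p n (algebraMap K Ω a) (algebraMap K Ω c) (p / e))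
    (h : IsPadicBase p W K₀ v)
    (φ : W →+* k) (hφ : Function.Surjective φ) (hker : RingHom.ker φ = Ideal.span {(p : W)})
    (he : e ≠ 0) (hK : Module.finrank K₀ K ≤ e) (hb : b ^ p = a)
    (hc : LeVal v 1 (algebraMap K Ω c ^ p - algebraMap K Ω c)) (hμ0 : μ ≠ 0)
    (hμ : v (algebraMap K Ω μ) = 1 / e) {L : K[X]} (hL0 : L ≠ 0)
    (hLdeg : L.natDegree ≤ p ^ n * p ^ n)
    (hL : ∀ x : Ω, aeval x L =
      monodromyEval (p ^ n) (algebraMap K Ω a) (algebraMap K Ω c) x)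
    (hy : aeval y L = 0) :
    IsGalois K (IntermediateField.adjoin K {y}) ∧
    Nonempty (Gal(IntermediateField.adjoin K {y}/K) ≃* Multiplicative (Fin (2 * n) → ZMod p)) := by
  have hv := D.val
  have hyE := hL y ▸ hy
  obtain ⟨hfin₀, hF, hdeg, π, hπ0, hπ⟩ :=
    D.exists_uniformizer h he hK hb hc hμ0 hμ hL0 hLdeg hy hyE
  have hQpos : 0 < p ^ n * p ^ n := by have := D.prime.pos; positivity
  have hN : e * (p ^ n * p ^ n) ≠ 0 := mul_ne_zero he hQpos.ne'
  set F := IntermediateField.adjoin K {y} with hFdef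
  have hfin : FiniteDimensional K F :=
    FiniteDimensional.of_finrank_pos (by rw [hdeg]; exact pow_pos D.prime.pos _)
  have hmapF : ∀ x : K, algebraMap F Ω (algebraMap K F x) = algebraMap K Ω x :=
    fun x => (IsScalarTower.algebraMap_apply K F Ω x).symm
  have DF : IsMonodromyDatum v p n (algebraMap F Ω (algebraMap K F a))
      (algebraMap F Ω (algebraMap K F c)) (p / e) := by rwa [hmapF, hmapF]
  set η : F := algebraMap K F μ ^ p with hηdef
  have hμ0' : algebraMap K Ω μ ≠ 0 := by simpa using hμ0
  have hη0 : η ≠ 0 := pow_ne_zero _ (by simpa using hμ0)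
  have hη : v (algebraMap F Ω η) = p / e := by
    rw [hηdef, map_pow, hmapF, hv.map_pow hμ0', hμ, mul_one_div]
  have hp0 : (p : Ω) ≠ 0 := by exact_mod_cast D.prime.ne_zero
  set y₁ : F := IntermediateField.AdjoinSimple.gen K y with hy₁
  have hrootΩ : ∀ x : F, monodromyEval (p ^ n) (algebraMap K F a) (algebraMap K F c) x = 0 ↔
      aeval x L = 0 := by
    intro x
    rw [← (algebraMap F Ω).injective.eq_iff, algebraMap_monodromyEval, hmapF, hmapF, ← hL,
      map_zero, aeval_algebraMap_apply, map_eq_zero]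
  have hroot₁ : monodromyEval (p ^ n) (algebraMap K F a) (algebraMap K F c) y₁ = 0 := by
    rw [hrootΩ, ← map_eq_zero (algebraMap F Ω), ← aeval_algebraMap_apply]
    exact hy
  have hrootσ : ∀ (σ : Gal(F/K)) (x : F),
      monodromyEval (p ^ n) (algebraMap K F a) (algebraMap K F c) x = 0 →
      monodromyEval (p ^ n) (algebraMap K F a) (algebraMap K F c) (σ x) = 0 := by
    intro σ x hx
    rw [hrootΩ] at hx ⊢
    have := congrArg σ hx
    rwa [map_zero, ← AlgEquiv.coe_toAlgHom, ← aeval_algHom_apply] at this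
  have hnormal : Normal K F := by
    rw [IntermediateField.normal_iff_forall_map_le]
    intro σ
    rw [hFdef, IntermediateField.adjoin_map, Set.image_singleton,
      IntermediateField.adjoin_simple_le_iff]
    have hσ : aeval (σ y) L = 0 := by rw [aeval_algHom_apply, hy, map_zero]
    rw [hL, ← hmapF, ← hmapF] at hσ
    obtain ⟨x, hx⟩ := DF.mem_range_of_root h hN hπ0 hπ hF φ hφ hker hη0 hη hp0 hroot₁ hσ
    rw [← hx]
    exact x.2
  have : CharZero K := (algebraMap K Ω).charZero
  have hgal : IsGalois K F := ⟨⟩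
  refine ⟨hgal, ?_⟩
  have hfix : ∀ σ : Gal(F/K), σ η = η := fun σ => by
    rw [hηdef, ← map_pow, AlgEquiv.commutes]
  have hdiff : ∀ (τ : Gal(F/K)) (x x' : F),
      monodromyEval (p ^ n) (algebraMap K F a) (algebraMap K F c) x = 0 →
      monodromyEval (p ^ n) (algebraMap K F a) (algebraMap K F c) x' = 0 →
      LtVal v (p / e) (algebraMap F Ω (τ x' - τ x - (x' - x))) := fun τ x x' hx hx' =>
    DF.aut_diff_lt h hN hπ0 hπ hF hη0 hη hx hx' (τ.restrictScalars K₀) (hfix τ)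
  have huniq : ∀ x x' : F,
      monodromyEval (p ^ n) (algebraMap K F a) (algebraMap K F c) x = 0 →
      monodromyEval (p ^ n) (algebraMap K F a) (algebraMap K F c) x' = 0 →
      LtVal v (p / e) (algebraMap F Ω (x' - x)) → x' = x := by
    intro x x' hx hx' hlt
    apply (algebraMap F Ω).injective
    refine DF.root_unique ?_ ?_ (by rwa [← map_sub])
    · rw [← algebraMap_monodromyEval, hx, map_zero]
    · rw [← algebraMap_monodromyEval, hx', map_zero]
  have hext : ∀ σ τ : Gal(F/K), σ y₁ = τ y₁ → σ = τ := by
    intro σ τ hστ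
    have : σ.toAlgHom = τ.toAlgHom := by
      refine IntermediateField.algHom_ext_of_eq_adjoin K hFdef ?_
      rintro _ rfl
      exact hστ
    exact AlgEquiv.coe_toAlgHom_injective this
  refine nonempty_mulEquiv_of_pow_eq_one (fun σ τ => hext _ _ ?_) (fun σ => hext _ _ ?_)
    ((IsGalois.card_aut_eq_finrank K F).trans hdeg)
  · refine huniq _ _ (hrootσ _ _ hroot₁) (hrootσ _ _ hroot₁) ?_
    have h1 := hdiff σ _ _ hroot₁ (hrootσ τ _ hroot₁)
    have h2 := hdiff τ _ _ hroot₁ (hrootσ σ _ hroot₁)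
    have := hv.lt_sub h1 h2
    rw [← map_sub] at this
    convert this using 2
    simp only [AlgEquiv.mul_apply]
    ring
  · have hrootpow : ∀ j : ℕ,
        monodromyEval (p ^ n) (algebraMap K F a) (algebraMap K F c) ((σ ^ j) y₁) = 0 :=
      fun j => hrootσ _ _ hroot₁
    have hpow : ∀ j : ℕ, LtVal v (p / e)
        (algebraMap F Ω ((σ ^ j) y₁ - y₁ - j * (σ y₁ - y₁))) := by
      intro j
      induction j with
      | zero => left; simp
      | succ j ih =>
        have h1 := hdiff σ _ _ hroot₁ (hrootpow j)
        have := hv.lt_add ih h1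
        rw [← map_add] at this
        convert this using 2
        rw [pow_succ', AlgEquiv.mul_apply]
        push_cast
        ring
    refine huniq _ _ (hrootσ _ _ hroot₁) (hrootpow p) ?_
    have hroot_im : ∀ x : F,
        monodromyEval (p ^ n) (algebraMap K F a) (algebraMap K F c) x = 0 →
        monodromyEval (p ^ n) (algebraMap F Ω (algebraMap K F a))
          (algebraMap F Ω (algebraMap K F c)) (algebraMap F Ω x) = 0 :=
      fun x hx => by rw [← algebraMap_monodromyEval, hx, map_zero]
    have hpd : LtVal v (p / e) (algebraMap F Ω (p * (σ y₁ - y₁))) := by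
      have hp1 : LtVal v 0 (p : Ω) := Or.inr (by rw [D.val_p]; exact one_pos)
      have := hv.lt_mul_le hp1
        (DF.root_diff_le (hroot_im _ hroot₁) (hroot_im _ (hrootσ σ _ hroot₁)))
      simpa using this
    have := hv.lt_add (hpow p) hpd
    rw [← map_add] at this
    convert this using 2
    rw [AlgEquiv.one_apply]
    ring

end Galois

section Base

variable {p : ℕ} {W K₀ Ω : Type*} [CommRing W] [IsDomain W] [Field K₀] [Field Ω] [Algebra W K₀]
  [Algebra K₀ Ω] [Algebra W Ω] [IsScalarTower W K₀ Ω] [IsFractionRing W K₀] {v : Ω → ℚ}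

lemma IsExpVal.isPadicBase (hv : IsExpVal v) (hp0 : (p : W) ≠ 0) (hvp : v (p : Ω) = 1)
    (hfac : ∀ w : W, w ≠ 0 → ∃ (m : ℕ) (u : Wˣ), w = (p : W) ^ m * u)
    (hW : ∀ w : W, w ≠ 0 → 0 ≤ v (algebraMap K₀ Ω (algebraMap W K₀ w))) :
    IsPadicBase p W K₀ v := by
  have hinj : Function.Injective (algebraMap W Ω) := by
    rw [IsScalarTower.algebraMap_eq W K₀ Ω]
    exact (algebraMap K₀ Ω).injective.comp (IsFractionRing.injective W K₀)
  have hW' : ∀ w : W, w ≠ 0 → 0 ≤ v (algebraMap W Ω w) := fun w hw => by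
    rw [IsScalarTower.algebraMap_apply W K₀ Ω]
    exact hW w hw
  have hne : ∀ w : W, w ≠ 0 → algebraMap W Ω w ≠ 0 := fun w hw => by
    rwa [Ne, map_eq_zero_iff _ hinj]
  have hp0Ω : (p : Ω) ≠ 0 := by simpa using hne p hp0
  have hunit : ∀ u : Wˣ, v (algebraMap W Ω u) = 0 := fun u => by
    have h1 : algebraMap W Ω u * algebraMap W Ω (u⁻¹ : Wˣ) = 1 := by rw [← map_mul]; simp
    have h2 := hv.mul _ _ (hne _ u.ne_zero) (hne _ (u⁻¹).ne_zero)
    rw [h1, hv.map_one] at h2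
    linarith [hW' _ u.ne_zero, hW' _ (u⁻¹).ne_zero]
  have hval : ∀ (m : ℕ) (u : Wˣ), v (algebraMap W Ω ((p : W) ^ m * u)) = m := fun m u => by
    rw [map_mul, _root_.map_pow, map_natCast, hv.mul _ _ (pow_ne_zero _ hp0Ω) (hne _ u.ne_zero),
      hv.map_pow hp0Ω, hvp, hunit]
    ring
  have hfrac : ∀ x : K₀, x ≠ 0 → ∃ (m m' : ℕ) (u u' : Wˣ),
      x * algebraMap W K₀ ((p : W) ^ m' * u') = algebraMap W K₀ ((p : W) ^ m * u) ∧
      v (algebraMap K₀ Ω x) = m - m' := by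
    intro x hx
    obtain ⟨w, w', hw', rfl⟩ := IsFractionRing.div_surjective (A := W) x
    have hw'0 : w' ≠ 0 := nonZeroDivisors.ne_zero hw'
    have hw0 : w ≠ 0 := by rintro rfl; simp at hx
    have hw'K : algebraMap W K₀ w' ≠ 0 := by
      rwa [Ne, map_eq_zero_iff _ (IsFractionRing.injective W K₀)]
    obtain ⟨m, u, rfl⟩ := hfac w hw0
    obtain ⟨m', u', rfl⟩ := hfac w' hw'0
    refine ⟨m, m', u, u', div_mul_cancel₀ _ hw'K, ?_⟩
    rw [map_div₀, ← IsScalarTower.algebraMap_apply, ← IsScalarTower.algebraMap_apply,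
      hv.map_div (hne _ hw0) (hne _ hw'0), hval, hval]
  refine ⟨hv, hvp, fun w => ?_, fun x hx => ?_, fun x hx => ?_⟩
  · by_cases hw : w = 0
    · exact Or.inl (by simp [hw])
    · exact Or.inr (hW' w hw)
  · obtain ⟨m, m', u, u', -, h⟩ := hfrac x hx
    exact ⟨m - m', by rw [h]; push_cast; rfl⟩
  · by_cases hx0 : x = 0
    · exact ⟨0, by simp [hx0]⟩
    obtain ⟨m, m', u, u', h1, h2⟩ := hfrac x hx0
    have h3 := hx.le_val (by simpa using hx0)
    rw [h2, sub_nonneg] at h3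
    have h4 : m' ≤ m := by exact_mod_cast h3
    refine ⟨(p : W) ^ (m - m') * u * (u'⁻¹ : Wˣ), ?_⟩
    have hne' : algebraMap W K₀ ((p : W) ^ m' * u') ≠ 0 := by
      rw [Ne, map_eq_zero_iff _ (IsFractionRing.injective W K₀)]
      exact mul_ne_zero (pow_ne_zero _ hp0) u'.ne_zero
    apply mul_right_cancel₀ hne'
    rw [h1, ← map_mul]
    congr 1
    rw [← Nat.sub_add_cancel h4, Nat.add_sub_cancel, pow_add]
    linear_combination (p : W) ^ (m - m') * u * p ^ m' * u'.inv_mul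

end Base

section Cyclotomic

variable {Ω : Type*} [Field Ω] {v : Ω → ℚ}

lemma IsExpVal.le_pow_sub_one (hv : IsExpVal v) {x : Ω} (hx : LeVal v 0 x) (i : ℕ) :
    LeVal v (v (x - 1)) (x ^ i - 1) := by
  rw [← mul_geom_sum]
  have := hv.le_mul (LeVal.self (v := v) (x - 1))
    (hv.le_sum (Finset.range i) _ fun j _ => hv.le_pow_zero hx j)
  rwa [add_zero] at this

/-- The valuation of `ζ - 1` for a primitive `p`-th root of unity `ζ`. -/
lemma IsExpVal.val_primitiveRoot_sub_one (hv : IsExpVal v) {p : ℕ} (hp : p.Prime)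
    (hvp : v (p : Ω) = 1) {ζ : Ω} (hζ : IsPrimitiveRoot ζ p) :
    v (ζ - 1) = 1 / ((p : ℚ) - 1) := by
  have hle : ∀ x : Ω, x ^ p = 1 → LeVal v 0 x := fun x hx =>
    hv.le_pow_imp hp.ne_zero (by rw [hx, mul_zero]; exact hv.le_one)
  have hval : ∀ i, 0 < i → i < p → 1 - ζ ^ i ≠ 0 ∧ v (1 - ζ ^ i) = v (ζ - 1) := by
    intro i hi hip
    have hprim := hζ.pow_of_coprime i (hp.coprime_iff_not_dvd.mpr
      (Nat.not_dvd_of_pos_of_lt hi hip)).symm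
    have h1 : ζ ^ i - 1 ≠ 0 := sub_ne_zero.mpr (hprim.ne_one hp.one_lt)
    have h2 : ζ - 1 ≠ 0 := sub_ne_zero.mpr (hζ.ne_one hp.one_lt)
    have := NeZero.mk hp.ne_zero
    obtain ⟨j, -, hj⟩ := hprim.eq_pow_of_pow_eq_one hζ.pow_eq_one
    have h3 := (hv.le_pow_sub_one (hle _ hζ.pow_eq_one) i).le_val h1
    have h4 := hv.le_pow_sub_one (hle _ hprim.pow_eq_one) j
    rw [hj] at h4
    have h5 := h4.le_val h2
    rw [← neg_sub (ζ ^ i), hv.map_neg]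
    exact ⟨neg_ne_zero.mpr h1, le_antisymm h5 h3⟩
  obtain ⟨r, rfl⟩ : ∃ r, p = r + 1 := ⟨p - 1, (Nat.sub_add_cancel hp.one_le).symm⟩
  have hr : (r : ℚ) ≠ 0 := by
    have := hp.two_le
    exact_mod_cast (by omega : r ≠ 0)
  have hprod := congrArg v hζ.prod_one_sub_pow_eq_order
  rw [← Nat.cast_add_one, hvp, hv.map_prod _ _ fun i hi =>
    (hval (i + 1) i.succ_pos (by have := Finset.mem_range.mp hi; omega)).1,
    Finset.sum_congr rfl fun i hi =>
    (hval (i + 1) i.succ_pos (by have := Finset.mem_range.mp hi; omega)).2, Finset.sum_const,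
    Finset.card_range, nsmul_eq_mul] at hprod
  push_cast
  rw [add_sub_cancel_right, eq_div_iff hr]
  linarith

/-- The degree of the field generated by a `d`-th root of `ζ - 1`. -/
lemma finrank_adjoin_le {K₀ : Type*} [Field K₀] [Algebra K₀ Ω] {p d : ℕ} (hp : p.Prime)
    (hd : d ≠ 0) {ζ μ : Ω} (hζ : IsPrimitiveRoot ζ p) (hμ : μ ^ d = ζ - 1) :
    FiniteDimensional K₀ (IntermediateField.adjoin K₀ {μ}) ∧
    Module.finrank K₀ (IntermediateField.adjoin K₀ {μ}) ≤ (p - 1) * d := by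
  set P : K₀[X] := (cyclotomic p K₀).comp (X ^ d + C 1) with hP
  have hdeg : P.natDegree = (p - 1) * d := by
    rw [hP, natDegree_comp, natDegree_cyclotomic, Nat.totient_prime hp, natDegree_X_pow_add_C]
  have hmonic : P.Monic := (cyclotomic.monic p K₀).comp (monic_X_pow_add_C 1 hd)
    (by rwa [natDegree_X_pow_add_C])
  have hroot : aeval μ P = 0 := by
    have := NeZero.mk hp.ne_zero
    rw [hP, aeval_comp]
    have h1 : aeval μ (X ^ d + C 1 : K₀[X]) = ζ := by simp [hμ]
    rw [h1, aeval_def, eval₂_eq_eval_map, map_cyclotomic]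
    exact hζ.isRoot_cyclotomic hp.pos
  have hint : IsIntegral K₀ μ := ⟨P, hmonic, hroot⟩
  refine ⟨IntermediateField.adjoin.finiteDimensional hint, ?_⟩
  rw [IntermediateField.adjoin.finrank hint, ← hdeg]
  exact natDegree_le_of_dvd (minpoly.dvd K₀ μ hroot) hmonic.ne_zero

end Cyclotomic

section Coefficients

variable {p n : ℕ}

lemma aCoef_eq_pow (R : Type) [CommRing R] (hn : n ≠ 0) :
    ((-1) ^ p ^ (n - 1) * (-(p : R)) ^ ∑ i ∈ Finset.range n, p ^ i) ^ p = aCoef R p n := by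
  rw [aCoef, mul_pow, ← pow_mul, ← pow_mul, ← pow_succ, Nat.sub_add_cancel (Nat.pos_of_ne_zero hn),
    Finset.sum_mul]
  simp only [pow_succ]

lemma map_aCoef {R S : Type} [CommRing R] [CommRing S] (f : R →+* S) :
    f (aCoef R p n) = aCoef S p n := by
  simp [aCoef]

lemma aeval_Lpoly {K Ω : Type} [Field K] [Field Ω] [Algebra K Ω] (c : K) (x : Ω) :
    aeval x (Lpoly K p n c) =
      monodromyEval (p ^ n) (algebraMap K Ω (aCoef K p n)) (algebraMap K Ω c) x := by
  simp [Lpoly, fqc, monodromyEval]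

lemma natDegree_fqc_le {K : Type} [Field K] (c : K) : (fqc K p n c).natDegree ≤ p ^ n + 1 := by
  unfold fqc
  compute_degree

lemma natDegree_Lpoly_le {K : Type} [Field K] (hp : p.Prime) (hn : n ≠ 0) (c : K) :
    (Lpoly K p n c).natDegree ≤ p ^ n * p ^ n := by
  have hq : 2 ≤ p ^ n := hp.two_le.trans (Nat.le_self_pow hn p)
  refine (natDegree_sub_le _ _).trans (max_le (natDegree_X_pow _).le ?_)
  have h1 : (C (aCoef K p n) * (C c + X)).natDegree ≤ 1 := by compute_degree
  have h2 := (natDegree_pow (fqc K p n c) (p ^ n - 1)).le.trans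
    (Nat.mul_le_mul_left _ (natDegree_fqc_le c))
  refine natDegree_mul_le.trans ((add_le_add h1 h2).trans ?_)
  obtain ⟨r, hr⟩ := Nat.exists_eq_add_of_le hq
  rw [hr, show 2 + r - 1 = r + 1 by omega]
  nlinarith

lemma Lpoly_ne_zero {K : Type} [Field K] (hp : p.Prime) (c : K) (hc : c ≠ 0)
    (ha : aCoef K p n ≠ 0) : Lpoly K p n c ≠ 0 := by
  intro h
  have hp0 := hp.ne_zero
  have := congrArg (eval 0) h
  simp [Lpoly, fqc, hp0, hc, ha] at this

lemma IsExpVal.val_aCoef {Ω : Type} [Field Ω] {v : Ω → ℚ} (hv : IsExpVal v) (hp : p.Prime)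
    (hp0 : (p : Ω) ≠ 0) (hvp : v (p : Ω) = 1) :
    aCoef Ω p n ≠ 0 ∧
      v (aCoef Ω p n) =
        p / (((p : ℚ) - 1) * ((p : ℚ) ^ n + 1)) * ((p : ℚ) ^ n * (p : ℚ) ^ n - 1) := by
  have h1 : (-1 : Ω) ≠ 0 := neg_ne_zero.mpr one_ne_zero
  have h2 : (-(p : Ω)) ≠ 0 := neg_ne_zero.mpr hp0
  refine ⟨mul_ne_zero (pow_ne_zero _ h1) (pow_ne_zero _ h2), ?_⟩
  have hp1 : (0 : ℚ) < (p : ℚ) - 1 := sub_pos.mpr (by exact_mod_cast hp.one_lt)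
  have hgeom := mul_geom_sum (p : ℚ) n
  rw [aCoef, hv.mul _ _ (pow_ne_zero _ h1) (pow_ne_zero _ h2), hv.map_pow h1, hv.map_pow h2,
    hv.map_neg_one, hv.map_neg, hvp]
  push_cast
  simp only [pow_succ, ← Finset.sum_mul]
  have hq : (0 : ℚ) < (p : ℚ) ^ n + 1 := by positivity
  field_simp
  linear_combination ((p : ℚ) ^ n + 1) * p * hgeom

/-- An element congruent to its `p`-th power modulo `p` and of valuation less than `1` is a unit. -/
lemma IsExpVal.val_eq_zero_of_pow_sub {Ω : Type*} [Field Ω] {v : Ω → ℚ} (hv : IsExpVal v)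
    (hp : p.Prime) {c : Ω} (hc0 : c ≠ 0) (hc : 0 ≤ v c) (hc1 : v c < 1)
    (hcp : LeVal v 1 (c ^ p - c)) : v c = 0 := by
  by_contra hne
  have hpos : 0 < v c := lt_of_le_of_ne hc (Ne.symm hne)
  have hpow : LtVal v (v (-c)) (c ^ p) := by
    right
    rw [hv.map_neg, hv.map_pow hc0]
    have : (1 : ℚ) < p := by exact_mod_cast hp.one_lt
    nlinarith
  obtain ⟨h1, h2⟩ := hv.add_dominant (neg_ne_zero.mpr hc0) hpow
  rw [neg_add_eq_sub] at h1 h2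
  have := hcp.le_val h1
  rw [h2, hv.map_neg] at this
  linarith

lemma charZero_wittVector (p : ℕ) [Fact p.Prime] (k : Type*) [Field k] [CharP k p] :
    CharZero (WittVector p k) := by
  have hp := (Fact.out : p.Prime)
  refine charZero_of_inj_zero fun m hm => ?_
  by_contra hm0
  obtain ⟨j, u, hu, rfl⟩ := Nat.exists_eq_pow_mul_and_not_dvd hm0 p hp.ne_one
  rw [Nat.cast_mul, Nat.cast_pow, mul_eq_zero] at hm
  have hu0 := hm.resolve_left (pow_ne_zero _ (WittVector.p_nonzero p k))
  have := congrArg WittVector.constantCoeff hu0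
  rw [map_natCast, map_zero, CharP.cast_eq_zero_iff k p] at this
  exact hu this

instance charZero_Omg (p : ℕ) [Fact p.Prime] : CharZero (Omg p) := by
  have := charZero_wittVector p (AlgebraicClosure (ZMod p))
  have : CharZero (Kzero p) :=
    IsFractionRing.charZero_of_isFractionRing (R := WittVector p (AlgebraicClosure (ZMod p)))
  exact charZero_of_injective_algebraMap (algebraMap (Kzero p) (Omg p)).injective

end Coefficients

/-- for `c ∈ O_K` with `v(c^p − c) ≥ 1` and `v(c) < p/((q+1)(p−1))` and `y` a root
of `L_c`, the extension `K(y)/K` is Galois with group `(ℤ/pℤ)^(2n)`. -/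
theorem stmt_15 (p n : ℕ) [Fact p.Prime] (hn : 1 ≤ n)
    (v : Omg p → ℚ)
    (hv_mul : ∀ x y : Omg p, x ≠ 0 → y ≠ 0 → v (x * y) = v x + v y)
    (hv_add : ∀ x y : Omg p, x ≠ 0 → y ≠ 0 → x + y ≠ 0 → min (v x) (v y) ≤ v (x + y))
    (hv_p : v ((p : ℕ) : Omg p) = 1)
    (hv_W : ∀ x : WittVector p (AlgebraicClosure (ZMod p)), x ≠ 0 →
      0 ≤ v (algebraMap (Kzero p) (Omg p)
        (algebraMap (WittVector p (AlgebraicClosure (ZMod p))) (Kzero p) x)))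
    (ζ : Omg p) (hζ : IsPrimitiveRoot ζ p)
    (μ : Omg p) (hμ : μ ^ (p ^ n + 1) = ζ - 1)
    (c : ↥(IntermediateField.adjoin (Kzero p) {μ}))
    (hc0 : (c : Omg p) ≠ 0) (hc_nonneg : 0 ≤ v (c : Omg p))
    (hcp : (c : Omg p) ^ p - (c : Omg p) = 0 ∨ 1 ≤ v ((c : Omg p) ^ p - (c : Omg p)))
    (hc_lt : v (c : Omg p) < (p : ℚ) / (((p : ℚ) ^ n + 1) * ((p : ℚ) - 1)))
    (y : Omg p)
    (hy : Polynomial.aeval y (Lpoly ↥(IntermediateField.adjoin (Kzero p) {μ}) p n c) = 0) :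
    IsGalois ↥(IntermediateField.adjoin (Kzero p) {μ})
      ↥(IntermediateField.adjoin ↥(IntermediateField.adjoin (Kzero p) {μ}) {y}) ∧
    Nonempty
      ((↥(IntermediateField.adjoin ↥(IntermediateField.adjoin (Kzero p) {μ}) {y}) ≃ₐ[↥(IntermediateField.adjoin (Kzero p) {μ})]
        ↥(IntermediateField.adjoin ↥(IntermediateField.adjoin (Kzero p) {μ}) {y})) ≃*
        Multiplicative (Fin (2 * n) → ZMod p)) := by
  have hp := (Fact.out : p.Prime)
  have hn0 : n ≠ 0 := Nat.pos_iff_ne_zero.mp hn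
  have hv : IsExpVal v := ⟨hv_mul, hv_add⟩
  have hbase : IsPadicBase p (WittVector p (AlgebraicClosure (ZMod p))) (Kzero p) v :=
    hv.isPadicBase (WittVector.p_nonzero p _) hv_p
      (fun w hw => WittVector.exists_eq_pow_p_mul' w hw)
      hv_W
  let K := IntermediateField.adjoin (Kzero p) {μ}
  have hp0 : (p : Omg p) ≠ 0 := by exact_mod_cast hp.ne_zero
  have hp2 : (2 : ℚ) ≤ p := by exact_mod_cast hp.two_le
  have hq2 : (p : ℚ) ≤ (p : ℚ) ^ n := le_self_pow₀ (by linarith) hn0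
  have he : ((p - 1) * (p ^ n + 1) : ℕ) ≠ 0 :=
    mul_ne_zero (Nat.sub_pos_of_lt hp.one_lt).ne' (Nat.succ_ne_zero _)
  have hecast : (((p - 1) * (p ^ n + 1) : ℕ) : ℚ) = ((p : ℚ) - 1) * ((p : ℚ) ^ n + 1) := by
    push_cast [Nat.cast_sub hp.one_le]
    ring
  have hepos : 0 < ((p : ℚ) - 1) * ((p : ℚ) ^ n + 1) := by
    rw [← hecast]
    exact_mod_cast Nat.pos_of_ne_zero he
  have hρ1 : (p : ℚ) / (((p : ℚ) - 1) * ((p : ℚ) ^ n + 1)) < 1 := by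
    rw [div_lt_one hepos]
    nlinarith
  have hcv : v (c : Omg p) = 0 :=
    hv.val_eq_zero_of_pow_sub hp hc0 hc_nonneg
      (hc_lt.trans (by rwa [mul_comm ((p : ℚ) ^ n + 1)])) hcp
  obtain ⟨ha0, hva⟩ := hv.val_aCoef (n := n) hp hp0 hv_p
  have haK : algebraMap K (Omg p) (aCoef K p n) = aCoef (Omg p) p n := map_aCoef _
  have D : IsMonodromyDatum v p n (algebraMap K (Omg p) (aCoef K p n)) (algebraMap K (Omg p) c)
      (p / ((p - 1) * (p ^ n + 1) : ℕ)) :=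
    { val := hv
      prime := hp
      n_ne := hn0
      val_p := hv_p
      ρ_pos := by rw [hecast]; positivity
      ρ_lt := by rwa [hecast]
      a_ne := by rwa [haK]
      val_a := by rw [haK, hecast]; exact hva
      c_ne := hc0
      val_c := hcv }
  obtain ⟨hfin, hfinrank⟩ := finrank_adjoin_le (K₀ := Kzero p) hp (Nat.succ_ne_zero _) hζ hμ
  have hζ1 : ζ - 1 ≠ 0 := sub_ne_zero.mpr (hζ.ne_one hp.one_lt)
  have hμ0 : μ ≠ 0 := by
    rintro rfl
    exact hζ1 (by rw [← hμ, zero_pow (Nat.succ_ne_zero _)])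
  have hvμ : v μ = 1 / ((p - 1) * (p ^ n + 1) : ℕ) := by
    have h1 := hv.val_primitiveRoot_sub_one hp hv_p hζ
    rw [← hμ, hv.map_pow hμ0] at h1
    rw [hecast]
    push_cast at h1
    have : (p : ℚ) - 1 ≠ 0 := by linarith
    field_simp at h1 ⊢
    linarith
  have : Normal K (Omg p) := Normal.tower_top_of_normal (Kzero p) K (Omg p)
  exact D.isGalois_adjoin hbase WittVector.constantCoeff (WittVector.constantCoeff_surjective p)
    WittVector.ker_constantCoeff he hfinrank (aCoef_eq_pow K hn0) hcp
    (μ := IntermediateField.AdjoinSimple.gen (Kzero p) μ)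
    (fun h => hμ0 (congrArg Subtype.val h)) hvμ
    (Lpoly_ne_zero hp c (fun h => hc0 (congrArg Subtype.val h))
      (fun h => ha0 (by rw [← haK, h, map_zero])))
    (natDegree_Lpoly_le hp hn0 c) (aeval_Lpoly c) hy
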